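/- There exist constants c, C ∈ ℝ independent of M and a number M₀ > 0 such that for every M ≥ M₀ one has c ≤ Ψ*_M ≤ C, where Ψ*_M = sup_{γ∈ℱ} min_{ξ∈K} Ψ(γ(ξ)). -/

import Mathlib

open Real Set Metric Filter MeasureTheory

/-- The Laplacian of a real-valued function on the plane ℝ² ≅ ℂ. -/
noncomputable def planeLap (f : ℂ → ℝ) (x : ℂ) : ℝ :=
  fderiv ℝ (fun y => fderiv ℝ f y 1) x 1 +
  fderiv ℝ (fun y => fderiv ℝ f y Complex.I) x Complex.I

/-- A function is harmonic on a set if it is C² there with vanishing Laplacian. -/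
def HarmonicOnSet (f : ℂ → ℝ) (s : Set ℂ) : Prop :=
  ContDiffOn ℝ 2 f s ∧ ∀ x ∈ s, planeLap f x = 0

/-- `RegPart Ω H`: H is the regular part of the Dirichlet Green's function of −Δ on Ω:
for each x ∈ Ω, y ↦ H(x,y) is harmonic on Ω, extends continuously to the closure of Ω,
with boundary values (1/(2π))·log|x−y| on ∂Ω; moreover H is symmetric on Ω × Ω. -/
def RegPart (Ω : Set ℂ) (H : ℂ → ℂ → ℝ) : Prop :=
  (∀ x ∈ Ω, HarmonicOnSet (fun y => H x y) Ω ∧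
      ContinuousOn (fun y => H x y) (closure Ω) ∧
      ∀ y ∈ frontier Ω, H x y = (1 / (2 * π)) * Real.log ‖x - y‖) ∧
  (∀ x ∈ Ω, ∀ y ∈ Ω, H x y = H y x)

/-- The Green's function G(x,y) = (1/(2π))·log(1/|x−y|) + H(x,y). -/
noncomputable def green (H : ℂ → ℂ → ℝ) (x y : ℂ) : ℝ :=
  (1 / (2 * π)) * Real.log (1 / ‖x - y‖) + H x y

/-- The function Ψ(ξ) = (1/2)ΣH(ξ_j,ξ_j) − Σ_p (α_p/2)Σ_j G(ξ_j,p) + (1/2)Σ_{j≠k}G(ξ_j,ξ_k). -/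
noncomputable def PsiFun (H : ℂ → ℂ → ℝ) (Z : Finset ℂ) (α : ℂ → ℝ) {N : ℕ}
    (ξ : Fin N → ℂ) : ℝ :=
  (1 / 2) * ∑ j, H (ξ j) (ξ j) - ∑ p ∈ Z, (α p / 2) * ∑ j, green H (ξ j) p +
    (1 / 2) * ∑ j, ∑ k, if j ≠ k then green H (ξ j) (ξ k) else 0

/-- The function Φ(ξ) = (1/2)ΣH(ξ_j,ξ_j) − Σ_p (α_p/2)Σ_j G(ξ_j,p) − (1/2)Σ_{j≠k}G(ξ_j,ξ_k). -/
noncomputable def PhiFun (H : ℂ → ℂ → ℝ) (Z : Finset ℂ) (α : ℂ → ℝ) {N : ℕ}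
    (ξ : Fin N → ℂ) : ℝ :=
  (1 / 2) * ∑ j, H (ξ j) (ξ j) - ∑ p ∈ Z, (α p / 2) * ∑ j, green H (ξ j) p -
    (1 / 2) * ∑ j, ∑ k, if j ≠ k then green H (ξ j) (ξ k) else 0

/-- Membership in the configuration space ℳ = {ξ ∈ (Ω∖Z)^N : ξ_j ≠ ξ_k for j ≠ k}. -/
def memM (Ω : Set ℂ) (Z : Finset ℂ) {N : ℕ} (ξ : Fin N → ℂ) : Prop :=
  (∀ j, ξ j ∈ Ω ∧ ξ j ∉ Z) ∧ Function.Injective ξ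

/-- The cone {p + ρe^{i(θ_p+t)} : ρ ≥ 0, |t| ≤ δ} with vertex p. -/
def coneAt (θ : ℂ → ℝ) (δ : ℝ) (p : ℂ) : Set ℂ :=
  {z | ∃ ρ : ℝ, 0 ≤ ρ ∧ ∃ t : ℝ, |t| ≤ δ ∧
    z = p + (ρ : ℂ) * Complex.exp (((θ p + t : ℝ) : ℂ) * Complex.I)}

/-- Start index of the r-th consecutive block I_r of {0,…,N−1}. -/
def blkLo {m : ℕ} (Nr : Fin m → ℕ) (r : Fin m) : ℕ :=
  ∑ s ∈ Finset.univ.filter (fun s => s < r), Nr s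

/-- `inBlk Nr r j`: the index j belongs to the r-th consecutive block I_r. -/
def inBlk {m : ℕ} (Nr : Fin m → ℕ) (r : Fin m) {N : ℕ} (j : Fin N) : Prop :=
  blkLo Nr r ≤ (j : ℕ) ∧ (j : ℕ) < blkLo Nr r + Nr r

/-- `onRays θ δ P Nr ξ`: for every r and every j ∈ I_r the point ξ_j lies on the ray
emanating from p_r with angle θ_{p_r} + jδ/N, i.e. (ξ_j − p_r)/|ξ_j − p_r| = e^{i(θ_{p_r}+jδ/N)}. -/
def onRays (θ : ℂ → ℝ) (δ : ℝ) {m : ℕ} (P : Fin m → ℂ) (Nr : Fin m → ℕ) {N : ℕ}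
    (ξ : Fin N → ℂ) : Prop :=
  ∀ r : Fin m, ∀ j : Fin N, inBlk Nr r j →
    ξ j - P r = (‖ξ j - P r‖ : ℂ) *
      Complex.exp (((θ (P r) + ((j : ℕ) + 1) * δ / (N : ℝ) : ℝ) : ℂ) * Complex.I)

/-- The annulus U_r = {ξ : δ < |ξ − p| < 2δ}. -/
def annU (δ : ℝ) (p : ℂ) : Set ℂ := {z | δ < ‖z - p‖ ∧ ‖z - p‖ < 2 * δ}

/-- The open set {ξ ∈ U₁^{N₁} × … × U_m^{N_m} : |ξ_j − ξ_k| > M⁻¹ for j ≠ k}. -/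
def cfgOpen (δ : ℝ) {m : ℕ} (P : Fin m → ℂ) (Nr : Fin m → ℕ) (N : ℕ) (M : ℝ) :
    Set (Fin N → ℂ) :=
  {ξ | (∀ r : Fin m, ∀ j : Fin N, inBlk Nr r j → ξ j ∈ annU δ (P r)) ∧
    ∀ j k : Fin N, j ≠ k → M⁻¹ < ‖ξ j - ξ k‖}

/-- W = the connected component of the above open set containing ξ⁰. -/
def Wset (δ : ℝ) {m : ℕ} (P : Fin m → ℂ) (Nr : Fin m → ℕ) {N : ℕ} (ξ0 : Fin N → ℂ)
    (M : ℝ) : Set (Fin N → ℂ) :=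
  connectedComponentIn (cfgOpen δ P Nr N M) ξ0

/-- K = the closure of W. -/
def Kset (δ : ℝ) {m : ℕ} (P : Fin m → ℂ) (Nr : Fin m → ℕ) {N : ℕ} (ξ0 : Fin N → ℂ)
    (M : ℝ) : Set (Fin N → ℂ) :=
  closure (Wset δ P Nr ξ0 M)

/-- K₀ = {ξ ∈ K : min_{j≠k}|ξ_j − ξ_k| = M⁻¹}. -/
def K0set (δ : ℝ) {m : ℕ} (P : Fin m → ℂ) (Nr : Fin m → ℕ) {N : ℕ} (ξ0 : Fin N → ℂ)
    (M : ℝ) : Set (Fin N → ℂ) :=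
  {ξ | ξ ∈ Kset δ P Nr ξ0 M ∧ (∀ j k : Fin N, j ≠ k → M⁻¹ ≤ ‖ξ j - ξ k‖) ∧
    ∃ j k : Fin N, j ≠ k ∧ ‖ξ j - ξ k‖ = M⁻¹}

/-- 𝒟 = {ξ ∈ ℳ : Φ(ξ) > −M}. -/
def Dset (Ω : Set ℂ) (H : ℂ → ℂ → ℝ) (Z : Finset ℂ) (α : ℂ → ℝ) {N : ℕ} (M : ℝ) :
    Set (Fin N → ℂ) :=
  {ξ | memM Ω Z ξ ∧ -M < PhiFun H Z α ξ}

/-- ℱ: continuous maps γ : K → 𝒟 homotopic to the identity within 𝒟, the homotopy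
fixing K₀ pointwise. -/
def inF (Ω : Set ℂ) (H : ℂ → ℂ → ℝ) (Z : Finset ℂ) (α : ℂ → ℝ) (δ : ℝ) {m : ℕ}
    (P : Fin m → ℂ) (Nr : Fin m → ℕ) {N : ℕ} (ξ0 : Fin N → ℂ) (M : ℝ)
    (γ : (Fin N → ℂ) → (Fin N → ℂ)) : Prop :=
  ContinuousOn γ (Kset δ P Nr ξ0 M) ∧
  Set.MapsTo γ (Kset δ P Nr ξ0 M) (Dset Ω H Z α M) ∧
  ∃ Γ : ℝ × (Fin N → ℂ) → (Fin N → ℂ),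
    ContinuousOn Γ (Set.Icc (0 : ℝ) 1 ×ˢ Kset δ P Nr ξ0 M) ∧
    Set.MapsTo Γ (Set.Icc (0 : ℝ) 1 ×ˢ Kset δ P Nr ξ0 M) (Dset Ω H Z α M) ∧
    (∀ ξ ∈ Kset δ P Nr ξ0 M, Γ (0, ξ) = ξ) ∧
    (∀ ξ ∈ Kset δ P Nr ξ0 M, Γ (1, ξ) = γ ξ) ∧
    ∀ t ∈ Set.Icc (0 : ℝ) 1, ∀ ξ ∈ K0set δ P Nr ξ0 M, Γ (t, ξ) = ξ

/-- The max-min value Ψ*_M = sup_{γ∈ℱ} min_{ξ∈K} Ψ(γ(ξ)). -/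
noncomputable def PsiStar (Ω : Set ℂ) (H : ℂ → ℂ → ℝ) (Z : Finset ℂ) (α : ℂ → ℝ)
    (δ : ℝ) {m : ℕ} (P : Fin m → ℂ) (Nr : Fin m → ℕ) {N : ℕ} (ξ0 : Fin N → ℂ)
    (M : ℝ) : ℝ :=
  sSup {v | ∃ γ : (Fin N → ℂ) → (Fin N → ℂ), inF Ω H Z α δ P Nr ξ0 M γ ∧
    v = sInf ((fun ξ => PsiFun H Z α (γ ξ)) '' Kset δ P Nr ξ0 M)}

/-- Invariance of a function on `ℝⁿ` under integer translations. -/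
def IntPeriodic {n : ℕ} {F : Type*} (f : (Fin n → ℝ) → F) : Prop :=
  ∀ (k : Fin n → ℤ) (x : Fin n → ℝ), f (x + fun i => (k i : ℝ)) = f x

theorem IntPeriodic.exists_mem_Icc {n : ℕ} {F : Type*} {f : (Fin n → ℝ) → F}
    (hf : IntPeriodic f) (x : Fin n → ℝ) : ∃ y ∈ Icc (0 : Fin n → ℝ) 1, f y = f x := by
  refine ⟨fun i => Int.fract (x i), ⟨fun i => Int.fract_nonneg _,
    fun i => (Int.fract_lt_one _).le⟩, ?_⟩
  rw [← hf (fun i => ⌊x i⌋) fun i => Int.fract (x i)]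
  congr 1
  funext i
  exact Int.fract_add_floor (x i)

theorem mem_span_pi_basisFun_iff {n : ℕ} (v : Fin n → ℝ) :
    v ∈ Submodule.span ℤ (range (Pi.basisFun ℝ (Fin n))) ↔
      ∃ k : Fin n → ℤ, v = fun i => (k i : ℝ) := by
  rw [Module.Basis.mem_span_iff_repr_mem]
  constructor
  · intro h
    choose k hk using h
    refine ⟨k, funext fun i => ?_⟩
    simpa using (hk i).symm
  · rintro ⟨k, rfl⟩ i
    exact ⟨k i, by simp⟩

/-- Lagrange interpolation for the polynomial `t ↦ det (1 + tA)`: its value at `1` is an affine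
combination, with coefficients independent of `A`, of its values at `n + 1` given points. -/
theorem exists_det_id_add_eq_sum {n : ℕ} (v : Fin (n + 1) → ℝ) (hv : Function.Injective v) :
    ∃ c : Fin (n + 1) → ℝ, ∑ i, c i = 1 ∧ ∀ A : (Fin n → ℝ) →L[ℝ] (Fin n → ℝ),
      (ContinuousLinearMap.id ℝ _ + A).det =
        ∑ i, c i * (ContinuousLinearMap.id ℝ _ + v i • A).det := by
  refine ⟨fun i => (Lagrange.basis Finset.univ v i).eval 1, ?_, fun A => ?_⟩
  · rw [← Polynomial.eval_finsetSum, Lagrange.sum_basis hv.injOn Finset.univ_nonempty,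
      Polynomial.eval_one]
  · set B : Matrix (Fin n) (Fin n) ℝ := LinearMap.toMatrix' (A : (Fin n → ℝ) →ₗ[ℝ] (Fin n → ℝ))
    set p : Polynomial ℝ := ((Polynomial.X : Polynomial ℝ) • B.map Polynomial.C +
      (1 : Matrix (Fin n) (Fin n) ℝ).map Polynomial.C).det with hp
    have key : ∀ t : ℝ, p.eval t = (ContinuousLinearMap.id ℝ (Fin n → ℝ) + t • A).det := by
      intro t
      rw [ContinuousLinearMap.det, ← LinearMap.det_toMatrix', hp, ← Polynomial.coe_evalRingHom,
        RingHom.map_det]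
      congr 1
      ext i j
      rcases eq_or_ne i j with rfl | hij
      · simp [B, LinearMap.toMatrix'_apply, add_comm, mul_comm t]
      · simp [B, LinearMap.toMatrix'_apply, hij, mul_comm t]
    have hdeg : p.degree < (Finset.univ : Finset (Fin (n + 1))).card := by
      refine (Polynomial.natDegree_le_iff_degree_le.1
        (Polynomial.natDegree_det_X_add_C_le B 1)).trans_lt ?_
      simp only [Fintype.card_fin, Finset.card_univ]
      exact_mod_cast Nat.lt_succ_self n
    have h1 := Lagrange.eq_interpolate_of_eval_eq (fun i => p.eval (v i)) hv.injOn hdeg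
      fun _ _ => rfl
    have h2 := congrArg (Polynomial.eval 1) h1
    rw [Lagrange.interpolate_apply, Polynomial.eval_finsetSum, key, one_smul] at h2
    rw [h2]
    refine Finset.sum_congr rfl fun i _ => ?_
    rw [Polynomial.eval_mul, Polynomial.eval_C, key, mul_comm]

theorem IntPeriodic.intPeriodic_fderiv {n : ℕ} {F : Type*} [NormedAddCommGroup F] [NormedSpace ℝ F]
    {f : (Fin n → ℝ) → F} (hf : IntPeriodic f) : IntPeriodic (fderiv ℝ f) := by
  intro k x
  rw [← fderiv_comp_add_right]
  congr 1
  exact funext fun y => hf k y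

/-- For small `t` the map `x ↦ x + t f x` is a diffeomorphism of the torus, so its Jacobian has
total integral one. -/
theorem exists_forall_integral_det_eq_one {n : ℕ} {f : (Fin n → ℝ) → (Fin n → ℝ)}
    (hf : ContDiff ℝ 1 f) (hper : IntPeriodic f) :
    ∃ t₀ : ℝ, 0 < t₀ ∧ ∀ t ∈ Ioo 0 t₀,
      ∫ x in ZSpan.fundamentalDomain (Pi.basisFun ℝ (Fin n)),
        (ContinuousLinearMap.id ℝ (Fin n → ℝ) + t • fderiv ℝ f x).det = 1 := by
  have hdf : Continuous (fderiv ℝ f) := hf.continuous_fderiv one_ne_zero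
  obtain ⟨L, hL⟩ : ∃ L : NNReal, LipschitzWith L f := by
    obtain ⟨C, hC⟩ := (isCompact_Icc (a := (0 : Fin n → ℝ)) (b := 1)).exists_bound_of_continuousOn
      hdf.continuousOn
    refine ⟨C.toNNReal, lipschitzWith_of_nnnorm_fderiv_le (𝕜 := ℝ)
      (hf.differentiable one_ne_zero) fun x => ?_⟩
    obtain ⟨y, hy, hyx⟩ := hper.intPeriodic_fderiv.exists_mem_Icc x
    rw [← hyx, ← NNReal.coe_le_coe, coe_nnnorm]
    exact (hC y hy).trans (le_max_left _ _)
  have hdet : ∀ᶠ t : ℝ in nhds 0, ∀ x ∈ Icc (0 : Fin n → ℝ) 1,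
      0 < (ContinuousLinearMap.id ℝ (Fin n → ℝ) + t • fderiv ℝ f x).det := by
    refine isCompact_Icc.eventually_forall_of_forall_eventually fun y _ => ?_
    have hc : Continuous fun z : ℝ × (Fin n → ℝ) =>
        (ContinuousLinearMap.id ℝ (Fin n → ℝ) + z.1 • fderiv ℝ f z.2).det :=
      ContinuousLinearMap.continuous_det.comp
        (continuous_const.add (continuous_fst.smul (hdf.comp continuous_snd)))
    refine hc.continuousAt.eventually (lt_mem_nhds ?_)
    simp [ContinuousLinearMap.det]
  obtain ⟨t₁, ht₁, hdet⟩ := Metric.eventually_nhds_iff.1 hdet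
  refine ⟨min t₁ (1 / (L + 1)), lt_min ht₁ (by positivity), fun t ht => ?_⟩
  have ht0 : 0 < t := ht.1
  have htL : t * L < 1 := by
    have h1 : t < 1 / (L + 1) := ht.2.trans_le (min_le_right _ _)
    rw [lt_div_iff₀ (by positivity)] at h1
    linarith
  set D := ZSpan.fundamentalDomain (Pi.basisFun ℝ (Fin n)) with hD
  have hD' : D = univ.pi fun _ => Ico 0 1 := ZSpan.fundamentalDomain_pi_basisFun
  have hDI : D ⊆ Icc 0 1 := by
    rw [hD']
    exact fun x hx => ⟨fun i => (hx i trivial).1, fun i => (hx i trivial).2.le⟩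
  have hDm : MeasurableSet D := ZSpan.fundamentalDomain_measurableSet _
  have hDv : volume D = 1 := by
    rw [hD', volume_pi_pi]; simp
  set F : (Fin n → ℝ) → (Fin n → ℝ) := fun x => x + t • f x with hF
  have hlip : LipschitzWith (t.toNNReal * L) fun x => t • f x := by
    refine LipschitzWith.of_dist_le_mul fun x y => ?_
    rw [dist_smul₀, Real.norm_of_nonneg ht0.le, NNReal.coe_mul, Real.coe_toNNReal _ ht0.le,
      mul_assoc]
    exact mul_le_mul_of_nonneg_left (hL.dist_le_mul x y) ht0.le
  have hbij : ∀ y, ∃! x, F x = y := by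
    intro y
    have hcon : ContractingWith (t.toNNReal * L) fun x => y - t • f x := by
      refine ⟨by rw [← NNReal.coe_lt_coe]; simpa [ht0.le] using htL,
        LipschitzWith.of_dist_le_mul fun a b => ?_⟩
      rw [dist_sub_left]
      exact hlip.dist_le_mul a b
    refine ⟨hcon.fixedPoint, ?_, fun x hx => hcon.fixedPoint_unique ?_⟩
    · have := hcon.fixedPoint_isFixedPt
      rw [Function.IsFixedPt] at this
      simp only [hF]
      nth_rewrite 1 [← this]
      simp
    · simp only [Function.IsFixedPt, ← hx, hF, add_sub_cancel_right]
  have hinj : Function.Injective F := fun a b hab => (hbij (F b)).unique hab rfl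
  have hFd : ∀ x ∈ D, HasFDerivWithinAt F
      (ContinuousLinearMap.id ℝ (Fin n → ℝ) + t • fderiv ℝ f x) D x := fun x _ =>
    ((hasFDerivAt_id x).add
      (((hf.differentiable one_ne_zero) x).hasFDerivAt.const_smul t)).hasFDerivWithinAt
  have hFper : ∀ (k : Fin n → ℤ) x, F (x + fun i => (k i : ℝ)) = F x + fun i => (k i : ℝ) := by
    intro k x
    simp only [hF, hper k x]
    abel
  have hfund : IsAddFundamentalDomain
      (Submodule.span ℤ (range (Pi.basisFun ℝ (Fin n)))) (F '' D) volume := by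
    refine .mk' (measurable_image_of_fderivWithin hDm hFd hinj.injOn).nullMeasurableSet
      fun y => ?_
    obtain ⟨x, hx, -⟩ := hbij y
    have heq : ∀ g : Submodule.span ℤ (range (Pi.basisFun ℝ (Fin n))),
        g +ᵥ y ∈ F '' D ↔ g +ᵥ x ∈ D := by
      rintro ⟨g, hg⟩
      obtain ⟨k, rfl⟩ := (mem_span_pi_basisFun_iff g).1 hg
      have : (⟨_, hg⟩ : Submodule.span ℤ (range (Pi.basisFun ℝ (Fin n)))) +ᵥ y =
          F ((⟨_, hg⟩ : Submodule.span ℤ (range (Pi.basisFun ℝ (Fin n)))) +ᵥ x) := by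
        simp only [Submodule.vadd_def, vadd_eq_add]
        rw [add_comm _ x, hFper, hx, add_comm]
      rw [this, hinj.mem_set_image]
    simp only [heq]
    exact ZSpan.exist_unique_vadd_mem_fundamentalDomain (Pi.basisFun ℝ (Fin n)) x
  have hvol : volume (F '' D) = 1 := by
    rw [← hDv]
    have : VAddInvariantMeasure (Submodule.span ℤ (range (Pi.basisFun ℝ (Fin n))))
        (Fin n → ℝ) volume := inferInstanceAs <| VAddInvariantMeasure
          (Submodule.span ℤ (range (Pi.basisFun ℝ (Fin n)))).toAddSubgroup (Fin n → ℝ) volume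
    exact hfund.measure_eq (ZSpan.isAddFundamentalDomain (Pi.basisFun ℝ (Fin n)) volume)
  have hpos : ∀ x ∈ D, 0 < (ContinuousLinearMap.id ℝ (Fin n → ℝ) + t • fderiv ℝ f x).det :=
    fun x hx => hdet (by
      rw [dist_zero_right, Real.norm_of_nonneg ht0.le]
      exact ht.2.trans_le (min_le_left _ _)) x (hDI hx)
  have hcont : Continuous fun x =>
      (ContinuousLinearMap.id ℝ (Fin n → ℝ) + t • fderiv ℝ f x).det :=
    ContinuousLinearMap.continuous_det.comp (continuous_const.add (hdf.const_smul t))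
  have hlint := lintegral_abs_det_fderiv_eq_addHaar_image volume hDm hFd hinj.injOn
  rw [hvol] at hlint
  rw [integral_eq_lintegral_of_nonneg_ae
    ((ae_restrict_mem hDm).mono fun x hx => (hpos x hx).le) hcont.aestronglyMeasurable]
  rw [setLIntegral_congr_fun hDm
    (g := fun x => ENNReal.ofReal
      |(ContinuousLinearMap.id ℝ (Fin n → ℝ) + t • fderiv ℝ f x).det|)
    fun x hx => by simp only [abs_of_pos (hpos x hx)], hlint, ENNReal.toReal_one]

/-- The Jacobian of a `C¹` map commuting with integer translations does not vanish identically. -/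
theorem exists_det_id_add_fderiv_ne_zero {n : ℕ} {f : (Fin n → ℝ) → (Fin n → ℝ)}
    (hf : ContDiff ℝ 1 f) (hper : IntPeriodic f) :
    ∃ x, (ContinuousLinearMap.id ℝ (Fin n → ℝ) + fderiv ℝ f x).det ≠ 0 := by
  by_contra! hzero
  obtain ⟨t₀, ht₀, hint⟩ := exists_forall_integral_det_eq_one hf hper
  set v : Fin (n + 1) → ℝ := fun i => t₀ * (((i : ℕ) + 1) / (n + 2)) with hv
  have hvinj : Function.Injective v := by
    intro i j hij
    have h1 : (((i : ℕ) : ℝ) + 1) / (n + 2) = ((j : ℕ) + 1) / (n + 2) :=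
      mul_left_cancel₀ ht₀.ne' hij
    rw [div_left_inj' (by positivity)] at h1
    exact Fin.ext (by exact_mod_cast add_right_cancel h1)
  have hvI : ∀ i, v i ∈ Ioo 0 t₀ := by
    intro i
    refine ⟨by positivity, mul_lt_of_lt_one_right ht₀ ?_⟩
    rw [div_lt_one (by positivity)]
    have : ((i : ℕ) : ℝ) < n + 1 := by exact_mod_cast i.2
    linarith
  obtain ⟨c, hc, hsum⟩ := exists_det_id_add_eq_sum v hvinj
  have hdf : Continuous (fderiv ℝ f) := hf.continuous_fderiv one_ne_zero
  have hintg : ∀ i, IntegrableOn (fun x =>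
      c i * (ContinuousLinearMap.id ℝ (Fin n → ℝ) + v i • fderiv ℝ f x).det)
      (ZSpan.fundamentalDomain (Pi.basisFun ℝ (Fin n))) := by
    intro i
    have hcont : Continuous fun x =>
        c i * (ContinuousLinearMap.id ℝ (Fin n → ℝ) + v i • fderiv ℝ f x).det :=
      continuous_const.mul (ContinuousLinearMap.continuous_det.comp
        (continuous_const.add (hdf.const_smul (v i))))
    refine (hcont.continuousOn.integrableOn_compact (isCompact_Icc (a := 0) (b := 1))).mono_set ?_
    rw [ZSpan.fundamentalDomain_pi_basisFun]
    exact fun x hx => ⟨fun i => (hx i trivial).1, fun i => (hx i trivial).2.le⟩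
  have h := integral_finsetSum Finset.univ fun i _ => hintg i
  simp only [← hsum, hzero, integral_const_mul, fun i => hint (v i) (hvI i), mul_one, hc,
    integral_zero] at h
  exact zero_ne_one h

/-- A `C¹` function commuting with the unit translation, locally constant where
`cos (2πs) ≤ κ`. -/
theorem exists_contDiff_step (κ : ℝ) (hκ : κ < 1) :
    ∃ r b : ℝ → ℝ, Continuous b ∧ (∀ s, HasDerivAt r (b s) s) ∧
      (∀ s, r (s + 1) = r s + 1) ∧ ∀ s, cos (2 * π * s) ≤ κ → b s = 0 := by
  set b₀ : ℝ → ℝ := fun s => max 0 (cos (2 * π * s) - κ) with hb₀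
  have hcont : Continuous b₀ := by fun_prop
  have hper : Function.Periodic b₀ 1 := by
    intro s
    simp only [hb₀]
    rw [mul_add, mul_one, cos_add_two_pi]
  have hpos : 0 < ∫ s in (0 : ℝ)..1, b₀ s :=
    intervalIntegral.integral_pos one_pos hcont.continuousOn (fun _ _ => le_max_left _ _)
      ⟨0, by simp, by simp [hb₀, hκ]⟩
  set I := ∫ s in (0 : ℝ)..1, b₀ s
  refine ⟨fun s => (∫ u in (0 : ℝ)..s, b₀ u) / I, fun s => b₀ s / I, by fun_prop, fun s =>
    (intervalIntegral.integral_hasDerivAt_right (hcont.intervalIntegrable _ _)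
      (hcont.stronglyMeasurableAtFilter _ _) hcont.continuousAt).div_const I,
    fun s => ?_, fun s hs => ?_⟩
  · beta_reduce
    rw [div_add_one hpos.ne']
    congr 1
    rw [← intervalIntegral.integral_add_adjacent_intervals (hcont.intervalIntegrable 0 s)
      (hcont.intervalIntegrable s (s + 1)), hper.intervalIntegral_add_eq s 0, zero_add]
  · simp [hb₀, hs]

theorem add_intCast_of_add_one {r : ℝ → ℝ} (hr : ∀ s, r (s + 1) = r s + 1) (s : ℝ) (k : ℤ) :
    r (s + k) = r s + k := by
  have h : Function.Periodic (fun s => r s - s) 1 := fun s => by simp only [hr]; ring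
  have := (h.int_mul k) s
  simp only [mul_one] at this
  linarith

theorem IntPeriodic.exists_contDiff_approx {n : ℕ} {f : (Fin n → ℝ) → (Fin n → ℝ)}
    (hf : Continuous f) (hper : IntPeriodic f) {ε : ℝ} (hε : 0 < ε) :
    ∃ g : (Fin n → ℝ) → (Fin n → ℝ), ContDiff ℝ 1 g ∧ IntPeriodic g ∧ ∀ x, ‖g x - f x‖ ≤ ε := by
  obtain ⟨η, hη, huc⟩ := Metric.uniformContinuousOn_iff.1
    ((isCompact_Icc (a := (-1 : Fin n → ℝ)) (b := 2)).uniformContinuousOn_of_continuous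
      hf.continuousOn) ε hε
  have hunif : ∀ x y, dist y x < min η 1 → dist (f y) (f x) ≤ ε := by
    intro x y hxy
    set k : Fin n → ℤ := fun i => -⌊x i⌋
    rw [← hper k x, ← hper k y]
    have hd : dist (y + fun i => (k i : ℝ)) (x + fun i => (k i : ℝ)) < min η 1 := by
      rwa [dist_add_right]
    have hx : ∀ i, (x + fun i => (k i : ℝ)) i = Int.fract (x i) := fun i => by
      simp [k, Int.fract, sub_eq_add_neg]
    have hx0 : ∀ i, 0 ≤ (x + fun i => (k i : ℝ)) i := fun i => by
      rw [hx]; exact Int.fract_nonneg _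
    have hx1 : ∀ i, (x + fun i => (k i : ℝ)) i ≤ 1 := fun i => by
      rw [hx]; exact (Int.fract_lt_one _).le
    have hdi : ∀ i, |(y + fun i => (k i : ℝ)) i - (x + fun i => (k i : ℝ)) i| < 1 := fun i =>
      ((dist_le_pi_dist _ _ i).trans_lt hd).trans_le (min_le_right _ _)
    refine (huc _ ⟨fun i => ?_, fun i => ?_⟩ _ ⟨fun i => ?_, fun i => ?_⟩
      (hd.trans_le (min_le_left _ _))).le
    · have := (abs_lt.1 (hdi i)).1
      have := hx0 i
      simp only [Pi.neg_apply, Pi.one_apply]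
      linarith
    · have := (abs_lt.1 (hdi i)).2
      have := hx1 i
      simp only [Pi.ofNat_apply]
      linarith
    · have := hx0 i
      simp only [Pi.neg_apply, Pi.one_apply]
      linarith
    · have := hx1 i
      simp only [Pi.ofNat_apply]
      linarith
  have hmin : 0 < min η 1 := lt_min hη one_pos
  let φ : ContDiffBump (0 : Fin n → ℝ) := ⟨min η 1 / 2, min η 1, by positivity, by linarith⟩
  refine ⟨convolution (φ.normed volume) f (ContinuousLinearMap.lsmul ℝ ℝ) volume,
    ?_, fun k x => ?_, fun x => ?_⟩
  · exact_mod_cast φ.hasCompactSupport_normed.contDiff_convolution_left (n := 1) _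
      φ.contDiff_normed hf.locallyIntegrable
  · simp only [convolution_def]
    congr 1
    funext t
    rw [add_sub_right_comm, hper k]
  · rw [← dist_eq_norm]
    exact φ.dist_normed_convolution_le hf.aestronglyMeasurable fun y hy => hunif x y hy

/-- A continuous map of `ℝⁿ` at periodic distance from the identity is onto. -/
theorem IntPeriodic.surjective_id_add {n : ℕ} {f : (Fin n → ℝ) → (Fin n → ℝ)}
    (hf : Continuous f) (hper : IntPeriodic f) : Function.Surjective fun x => x + f x := by
  intro y
  by_contra! hy
  have hlt : ∀ x, ∑ i, cos (2 * π * (x i + f x i - y i)) < n := by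
    intro x
    by_contra! hle
    have hone : ∀ i ∈ Finset.univ, cos (2 * π * (x i + f x i - y i)) = 1 := by
      refine (Finset.sum_eq_sum_iff_of_le fun i _ => cos_le_one _).1 (le_antisymm ?_ ?_)
      · exact Finset.sum_le_sum fun i _ => cos_le_one _
      · simpa using hle
    have hk : ∀ i, ∃ k : ℤ, (k : ℝ) = x i + f x i - y i := by
      intro i
      obtain ⟨k, hk⟩ := (cos_eq_one_iff _).1 (hone i (Finset.mem_univ i))
      refine ⟨k, mul_left_cancel₀ two_pi_pos.ne' ?_⟩
      rw [← hk, mul_comm]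
    choose k hk using hk
    refine hy (x + fun i => ((-k i : ℤ) : ℝ)) ?_
    rw [hper]
    funext i
    have := hk i
    simp only [Pi.add_apply, Int.cast_neg]
    linarith
  set S : (Fin n → ℝ) → ℝ := fun x => ∑ i, cos (2 * π * (x i + f x i - y i)) with hS
  have hScont : Continuous S := by fun_prop
  have hSper : IntPeriodic S := by
    intro k x
    simp only [hS, hper k x, Pi.add_apply]
    refine Finset.sum_congr rfl fun i _ => ?_
    rw [← cos_add_int_mul_two_pi (2 * π * (x i + f x i - y i)) (k i)]
    congr 1
    ring
  obtain ⟨x₀, -, hmax⟩ := (isCompact_Icc (a := (0 : Fin n → ℝ)) (b := 1)).exists_isMaxOn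
    ⟨0, by simp⟩ hScont.continuousOn
  have hSle : ∀ x, S x ≤ S x₀ := by
    intro x
    obtain ⟨z, hz, hzx⟩ := hSper.exists_mem_Icc x
    rw [← hzx]
    exact hmax hz
  have hn : 0 < n := by
    rcases Nat.eq_zero_or_pos n with rfl | h
    · simpa using hlt 0
    · exact h
  have hn' : (0 : ℝ) < n := by exact_mod_cast hn
  set η : ℝ := (n - S x₀) / n with hη
  have hη0 : 0 < η := div_pos (sub_pos.2 (hlt x₀)) hn'
  obtain ⟨g, hgd, hgper, hgf⟩ := hper.exists_contDiff_approx hf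
    (show 0 < η / (4 * π) by positivity)
  obtain ⟨r, b, hbc, hrb, hr1, hb0⟩ := exists_contDiff_step (1 - η / 2) (by linarith)
  have hex : ∀ x, ∃ i, b (x i + g x i - y i) = 0 := by
    intro x
    obtain ⟨i, -, hi⟩ : ∃ i ∈ Finset.univ, cos (2 * π * (x i + f x i - y i)) ≤ 1 - η := by
      have : Nonempty (Fin n) := ⟨⟨0, hn⟩⟩
      refine Finset.exists_le_of_sum_le Finset.univ_nonempty ((hSle x).trans_eq ?_)
      simp only [hη, Finset.sum_const, Finset.card_univ, Fintype.card_fin, nsmul_eq_mul]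
      field_simp
      ring
    refine ⟨i, hb0 _ ?_⟩
    have h1 : |cos (2 * π * (x i + g x i - y i)) - cos (2 * π * (x i + f x i - y i))| ≤
        |2 * π * (x i + g x i - y i) - 2 * π * (x i + f x i - y i)| := by
      simpa [Real.dist_eq] using lipschitzWith_cos.dist_le_mul
        (2 * π * (x i + g x i - y i)) (2 * π * (x i + f x i - y i))
    have h2 : |g x i - f x i| ≤ η / (4 * π) := (norm_le_pi_norm (g x - f x) i).trans (hgf x)
    have h3 : 2 * π * (x i + g x i - y i) - 2 * π * (x i + f x i - y i) =
        2 * π * (g x i - f x i) := by ring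
    rw [h3, abs_mul, abs_of_pos two_pi_pos] at h1
    have h4 : 2 * π * |g x i - f x i| ≤ η / 2 := by
      calc 2 * π * |g x i - f x i| ≤ 2 * π * (η / (4 * π)) := by gcongr
        _ = η / 2 := by field_simp; ring
    have := le_abs_self (cos (2 * π * (x i + g x i - y i)) - cos (2 * π * (x i + f x i - y i)))
    linarith
  have hrC : ContDiff ℝ 1 r := by
    rw [contDiff_one_iff_deriv]
    refine ⟨fun s => (hrb s).differentiableAt, ?_⟩
    rwa [show deriv r = b from funext fun s => (hrb s).deriv]
  have hgi : ∀ i, ContDiff ℝ 1 fun x : Fin n → ℝ => g x i := fun i => contDiff_pi.1 hgd i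
  set F : (Fin n → ℝ) → (Fin n → ℝ) := fun x i => r (x i + g x i - y i) with hF
  have hFd : ContDiff ℝ 1 F := contDiff_pi.2 fun i =>
    hrC.comp (((contDiff_apply ℝ ℝ i).add (hgi i)).sub contDiff_const)
  have hper' : IntPeriodic fun x => F x - x := by
    intro k x
    funext i
    have := add_intCast_of_add_one hr1 (x i + g x i - y i) (k i)
    simp only [hF, hgper k x, Pi.sub_apply, Pi.add_apply]
    rw [show x i + (k i : ℝ) + g x i - y i = x i + g x i - y i + k i by ring, this]
    ring
  obtain ⟨x, hx⟩ := exists_det_id_add_fderiv_ne_zero (hFd.sub contDiff_id) hper'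
  have hFdx : DifferentiableAt ℝ F x := hFd.differentiable one_ne_zero x
  have hfd : fderiv ℝ (F - id) x = fderiv ℝ F x - ContinuousLinearMap.id ℝ _ := by
    rw [fderiv_sub hFdx differentiableAt_id, fderiv_id]
  rw [show (fun x => F x - id x) = F - id from rfl, hfd, add_sub_cancel] at hx
  obtain ⟨i, hi⟩ := hex x
  have hzero : ∀ v, fderiv ℝ F x v i = 0 := by
    intro v
    have h1 : HasFDerivAt (fun z => F z i) (b (x i + g x i - y i) •
        fderiv ℝ (fun z : Fin n → ℝ => z i + g z i - y i) x) x :=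
      (hrb _).comp_hasFDerivAt x ((((contDiff_apply ℝ ℝ i).add (hgi i)).sub
        contDiff_const).differentiable one_ne_zero x).hasFDerivAt
    have h2 := (hasFDerivAt_pi'.1 hFdx.hasFDerivAt i).unique h1
    have h3 := congrArg (fun A => A v) h2
    simpa [hi] using h3
  obtain ⟨v, hv⟩ := (LinearMap.equivOfDetNeZero _ hx).surjective (Pi.single i 1)
  have := congrFun hv i
  rw [Pi.single_eq_same] at this
  exact zero_ne_one ((hzero v).symm.trans this)

/-- Lifting of the angle along a homotopy of maps from the torus to the punctured plane. -/
theorem exists_intPeriodic_angle {n : ℕ} {g : ℝ × (Fin n → ℝ) → ℂ}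
    (hg : ContinuousOn g (Icc 0 1 ×ˢ univ)) (hne : ∀ t ∈ Icc (0 : ℝ) 1, ∀ x, g (t, x) ≠ 0)
    (hper : ∀ t ∈ Icc (0 : ℝ) 1, IntPeriodic fun x => g (t, x)) :
    ∃ f : (Fin n → ℝ) → ℝ, Continuous f ∧ IntPeriodic f ∧ ∀ x, ∃ c : ℝ, 0 < c ∧
      g (1, x) = c * (g (0, x) * Complex.exp (((2 * π * f x : ℝ) : ℂ) * Complex.I)) := by
  have hcpt : IsCompact (Icc (0 : ℝ) 1 ×ˢ Icc (0 : Fin n → ℝ) 1) := isCompact_Icc.prod isCompact_Icc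
  have hgK : ContinuousOn g (Icc (0 : ℝ) 1 ×ˢ Icc (0 : Fin n → ℝ) 1) :=
    hg.mono (prod_mono_right (subset_univ _))
  obtain ⟨z, hz, hmin⟩ := hcpt.exists_isMinOn ⟨(0, 0), by simp⟩ hgK.norm
  have hm : 0 < ‖g z‖ := norm_pos_iff.2 (hne z.1 hz.1 z.2)
  obtain ⟨η, hη, huc⟩ := Metric.uniformContinuousOn_iff.1
    (hcpt.uniformContinuousOn_of_continuous hgK) _ hm
  have hstep : ∀ s ∈ Icc (0 : ℝ) 1, ∀ t ∈ Icc (0 : ℝ) 1, dist s t < η → ∀ x,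
      ‖g (s, x) / g (t, x) - 1‖ < 1 := by
    intro s hs t ht hst x
    have hp : IntPeriodic fun x => g (s, x) / g (t, x) := fun k x => by
      simp only [show g (s, x + fun i => (k i : ℝ)) = g (s, x) from hper s hs k x,
        show g (t, x + fun i => (k i : ℝ)) = g (t, x) from hper t ht k x]
    obtain ⟨y, hy, hyx⟩ := hp.exists_mem_Icc x
    rw [← hyx]
    have h1 := huc (s, y) ⟨hs, hy⟩ (t, y) ⟨ht, hy⟩ (by
      rw [Prod.dist_eq, dist_self]
      exact max_lt hst hη)
    have h2 : ‖g z‖ ≤ ‖g (t, y)‖ := hmin ⟨ht, hy⟩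
    rw [div_sub_one (hne t ht y), norm_div, div_lt_one (hm.trans_le h2), ← dist_eq_norm]
    exact h1.trans_le h2
  obtain ⟨l, hl⟩ := exists_nat_one_div_lt hη
  have hl0 : (0 : ℝ) < l + 1 := by positivity
  have hmem : ∀ k ≤ l + 1, (k : ℝ) / (l + 1) ∈ Icc (0 : ℝ) 1 := fun k hk =>
    ⟨by positivity, (div_le_one hl0).2 (by exact_mod_cast hk)⟩
  suffices h : ∀ k ≤ l + 1, ∃ f : (Fin n → ℝ) → ℝ, Continuous f ∧ IntPeriodic f ∧
      ∀ x, ∃ c : ℝ, 0 < c ∧ g ((k : ℝ) / (l + 1), x) =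
        c * (g (0, x) * Complex.exp (((2 * π * f x : ℝ) : ℂ) * Complex.I)) by
    have := h (l + 1) le_rfl
    rwa [Nat.cast_add_one, div_self hl0.ne'] at this
  intro k
  induction k with
  | zero =>
    exact fun _ => ⟨fun _ => 0, continuous_const, fun _ _ => rfl, fun x => ⟨1, one_pos, by simp⟩⟩
  | succ k ih =>
    intro hk
    obtain ⟨f, hf, hfp, hfe⟩ := ih (by omega)
    set s : ℝ := ((k + 1 : ℕ) : ℝ) / (l + 1) with hs
    set t : ℝ := (k : ℝ) / (l + 1) with ht
    have hsI : s ∈ Icc (0 : ℝ) 1 := hmem _ hk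
    have htI : t ∈ Icc (0 : ℝ) 1 := hmem _ (by omega)
    have hst : dist s t < η := by
      rw [hs, ht, Real.dist_eq, ← sub_div]
      push_cast
      rwa [add_sub_cancel_left, abs_of_pos (by positivity)]
    have hslit : ∀ x, g (s, x) / g (t, x) ∈ Complex.slitPlane := fun x => by
      refine Or.inl ?_
      have h1 := hstep s hsI t htI hst x
      have h2 := (abs_lt.1 ((Complex.abs_re_le_norm _).trans_lt h1)).1
      rw [Complex.sub_re, Complex.one_re] at h2
      linarith
    have hcs : ∀ s ∈ Icc (0 : ℝ) 1, Continuous fun x => g (s, x) := fun s hs =>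
      hg.comp_continuous (by fun_prop) fun x => ⟨hs, trivial⟩
    refine ⟨fun x => f x + Complex.arg (g (s, x) / g (t, x)) / (2 * π), ?_, fun k x => ?_,
      fun x => ?_⟩
    · refine hf.add (Continuous.div_const ?_ _)
      rw [continuous_iff_continuousAt]
      exact fun x => (Complex.continuousAt_arg (hslit x)).comp
        (f := fun x => g (s, x) / g (t, x))
        ((hcs s hsI).div (hcs t htI) (hne t htI)).continuousAt
    · simp only [hfp k x, show g (s, x + fun i => (k i : ℝ)) = g (s, x) from hper s hsI k x,
        show g (t, x + fun i => (k i : ℝ)) = g (t, x) from hper t htI k x]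
    · obtain ⟨c, hc, hce⟩ := hfe x
      set q := g (s, x) / g (t, x) with hq
      have hq0 : q ≠ 0 := Complex.slitPlane_ne_zero (hslit x)
      refine ⟨‖q‖ * c, mul_pos (norm_pos_iff.2 hq0) hc, ?_⟩
      have h1 : g (s, x) = q * g (t, x) := (div_mul_cancel₀ _ (hne t htI x)).symm
      have h2 : (2 * π * (f x + q.arg / (2 * π)) : ℝ) = 2 * π * f x + q.arg := by
        field_simp
      rw [h1, hce, h2]
      nth_rewrite 1 [← Complex.norm_mul_exp_arg_mul_I q]
      push_cast
      rw [add_mul, Complex.exp_add]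
      ring

/-- The weak maximum principle on a bounded open set. -/
theorem harmonicOnSet_le_of_frontier_le {Ω : Set ℂ} (hΩo : IsOpen Ω)
    (hΩb : Bornology.IsBounded Ω) {f : ℂ → ℝ} (hf : HarmonicOnSet f Ω)
    (hfc : ContinuousOn f (closure Ω)) {B : ℝ} (hB : ∀ y ∈ frontier Ω, f y ≤ B) :
    ∀ y ∈ Ω, f y ≤ B := by
  intro x₀ hx₀
  by_contra! hlt
  obtain ⟨R, hR⟩ := hΩb.closure.exists_norm_le
  set ε : ℝ := (f x₀ - B) / (R ^ 2 + 1) with hε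
  have hε0 : 0 < ε := div_pos (sub_pos.2 hlt) (by positivity)
  have hεR : ε * R ^ 2 < f x₀ - B := by
    rw [hε, div_mul_eq_mul_div, div_lt_iff₀ (by positivity)]
    nlinarith
  obtain ⟨x₁, hx₁, hmax⟩ := hΩb.isCompact_closure.exists_isMaxOn ⟨x₀, subset_closure hx₀⟩
    (f := fun y => f y + ε * ‖y‖ ^ 2) (hfc.add (by fun_prop))
  have hx₁Ω : x₁ ∈ Ω := by
    by_contra hnot
    have h1 : f x₁ ≤ B := hB x₁ (by rw [hΩo.frontier_eq]; exact ⟨hx₁, hnot⟩)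
    have h2 : f x₀ + ε * ‖x₀‖ ^ 2 ≤ f x₁ + ε * ‖x₁‖ ^ 2 := hmax (subset_closure hx₀)
    have h3 : ε * ‖x₁‖ ^ 2 ≤ ε * R ^ 2 := by gcongr; exact hR x₁ hx₁
    have h4 : 0 ≤ ε * ‖x₀‖ ^ 2 := by positivity
    linarith
  have hC : ∀ y ∈ Ω, ContDiffAt ℝ 2 f y := fun y hy => hf.1.contDiffAt (hΩo.mem_nhds hy)
  have key : ∀ v : ℂ, ‖v‖ = 1 → fderiv ℝ (fun y => fderiv ℝ f y v) x₁ v + 2 * ε ≤ 0 := by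
    intro v hv
    by_contra! hpos
    set φ : ℝ → ℝ := fun s => f (x₁ + s • v) + ε * ‖x₁ + s • v‖ ^ 2 with hφ
    set w : ℝ := inner ℝ x₁ v with hw
    have hφ' : φ = fun s => f (x₁ + s • v) + ε * (‖x₁‖ ^ 2 + 2 * s * w + s ^ 2) := by
      funext s
      simp only [hφ]
      rw [norm_add_sq_real, inner_smul_right, norm_smul, hv, mul_one, Real.norm_eq_abs, sq_abs]
      ring
    have hline : ∀ s : ℝ, HasDerivAt (fun s : ℝ => x₁ + s • v) v s := fun s => by
      simpa using ((hasDerivAt_id s).smul_const v).const_add x₁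
    have hev : ∀ᶠ s : ℝ in nhds 0, x₁ + s • v ∈ Ω := by
      have hc : Continuous fun s : ℝ => x₁ + s • v := by fun_prop
      exact hc.continuousAt.eventually (hΩo.mem_nhds (by simpa using hx₁Ω))
    have hquad : ∀ s : ℝ, HasDerivAt (fun s : ℝ => ε * (‖x₁‖ ^ 2 + 2 * s * w + s ^ 2))
        (ε * (2 * w + 2 * s)) s := fun s => by
      have h1 := ((((hasDerivAt_id s).const_mul 2).mul_const w).const_add (‖x₁‖ ^ 2)).add
        (hasDerivAt_pow 2 s)
      simpa using h1.const_mul ε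
    have hd1 : ∀ᶠ s : ℝ in nhds 0,
        HasDerivAt φ (fderiv ℝ f (x₁ + s • v) v + ε * (2 * w + 2 * s)) s := by
      filter_upwards [hev] with s hs
      rw [hφ']
      exact (((hC _ hs).differentiableAt two_ne_zero).hasFDerivAt.comp_hasDerivAt s
        (hline s)).add (hquad s)
    have hderiv : deriv φ =ᶠ[nhds 0]
        fun s => fderiv ℝ f (x₁ + s • v) v + ε * (2 * w + 2 * s) :=
      hd1.mono fun s hs => hs.deriv
    have hd2 : HasDerivAt (fun s : ℝ => fderiv ℝ f (x₁ + s • v) v + ε * (2 * w + 2 * s))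
        (fderiv ℝ (fun y => fderiv ℝ f y v) x₁ v + 2 * ε) 0 := by
      have hfd : DifferentiableAt ℝ (fun y => fderiv ℝ f y v) x₁ :=
        (((hC x₁ hx₁Ω).fderiv_right (m := 1) (by norm_num)).differentiableAt
          one_ne_zero).clm_apply (differentiableAt_const v)
      have h1 : HasFDerivAt (fun y => fderiv ℝ f y v) (fderiv ℝ (fun y => fderiv ℝ f y v) x₁)
          (x₁ + (0 : ℝ) • v) := by simpa using hfd.hasFDerivAt
      refine (h1.comp_hasDerivAt (0 : ℝ) (hline 0)).add ?_
      have h2 := (((hasDerivAt_id (0 : ℝ)).const_mul 2).const_add (2 * w)).const_mul ε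
      simpa [mul_comm] using h2
    have hmaxφ : IsLocalMax φ 0 := by
      filter_upwards [hev] with s hs
      have := hmax (subset_closure hs)
      simpa [hφ] using this
    have hdd : deriv (deriv φ) 0 = fderiv ℝ (fun y => fderiv ℝ f y v) x₁ v + 2 * ε := by
      rw [hderiv.deriv_eq, hd2.deriv]
    have hminφ : IsLocalMin φ 0 := isLocalMin_of_deriv_deriv_pos (by rw [hdd]; exact hpos)
      hmaxφ.deriv_eq_zero hd1.self_of_nhds.continuousAt
    have hconst : φ =ᶠ[nhds 0] fun _ => φ 0 := by
      filter_upwards [hminφ, hmaxφ] with s h1 h2 using le_antisymm h2 h1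
    have : deriv (deriv φ) 0 = 0 := by
      rw [hconst.deriv.deriv_eq]
      simp
    linarith
  have h1 := key 1 (by simp)
  have h2 := key Complex.I (by simp)
  have h3 := hf.2 x₁ hx₁Ω
  rw [planeLap] at h3
  linarith

theorem harmonicOnSet_neg {Ω : Set ℂ} {f : ℂ → ℝ} (hf : HarmonicOnSet f Ω) :
    HarmonicOnSet (fun y => -f y) Ω := by
  refine ⟨hf.1.neg, fun x hx => ?_⟩
  have h := hf.2 x hx
  simp only [planeLap, fderiv_fun_neg, neg_apply] at h ⊢
  linarith

theorem RegPart.le_log {Ω : Set ℂ} (hΩo : IsOpen Ω) (hΩb : Bornology.IsBounded Ω)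
    {H : ℂ → ℂ → ℝ} (hH : RegPart Ω H) {D : ℝ} {x : ℂ} (hx : x ∈ Ω)
    (hD : ∀ y ∈ frontier Ω, ‖x - y‖ ≤ D) {y : ℂ} (hy : y ∈ Ω) :
    H x y ≤ (1 / (2 * π)) * Real.log D := by
  obtain ⟨h1, h2, h3⟩ := hH.1 x hx
  refine harmonicOnSet_le_of_frontier_le hΩo hΩb h1 h2 (fun z hz => ?_) y hy
  rw [h3 z hz]
  have hne : x ≠ z := by
    rintro rfl
    rw [hΩo.frontier_eq] at hz
    exact hz.2 hx
  have := norm_pos_iff.2 (sub_ne_zero.2 hne)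
  gcongr
  exact hD z hz

theorem RegPart.log_le {Ω : Set ℂ} (hΩo : IsOpen Ω) (hΩb : Bornology.IsBounded Ω)
    {H : ℂ → ℂ → ℝ} (hH : RegPart Ω H) {d : ℝ} (hd0 : 0 < d) {x : ℂ} (hx : x ∈ Ω)
    (hd : ∀ y ∈ frontier Ω, d ≤ ‖x - y‖) {y : ℂ} (hy : y ∈ Ω) :
    (1 / (2 * π)) * Real.log d ≤ H x y := by
  obtain ⟨h1, h2, h3⟩ := hH.1 x hx
  have := harmonicOnSet_le_of_frontier_le hΩo hΩb (harmonicOnSet_neg h1) h2.neg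
    (B := -((1 / (2 * π)) * Real.log d)) (fun z hz => ?_) y hy
  · linarith
  rw [h3 z hz]
  have := hd z hz
  gcongr

theorem exists_inBlk {m : ℕ} (Nr : Fin m → ℕ) {N : ℕ} (hN : N = ∑ r, Nr r) (j : Fin N) :
    ∃ r, inBlk Nr r j := by
  by_contra! h
  have key : ∀ r : Fin m, blkLo Nr r + Nr r ≤ j := by
    intro r
    induction r using WellFoundedLT.induction with
    | ind r ih =>
      have hlo : blkLo Nr r ≤ j := by
        rcases Nat.eq_zero_or_pos (r : ℕ) with h0 | h0
        · have : Finset.univ.filter (fun s => s < r) = ∅ := by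
            refine Finset.filter_eq_empty_iff.2 fun s _ => ?_
            rw [Fin.lt_def]
            omega
          simp [blkLo, this]
        · have hr1 : (r : ℕ) - 1 < m := by omega
          have h1 := ih ⟨r - 1, hr1⟩ (Fin.lt_def.2 (by simp only; omega))
          have : Finset.univ.filter (fun s => s < r) =
              insert ⟨(r : ℕ) - 1, hr1⟩
                (Finset.univ.filter (fun s => s < (⟨(r : ℕ) - 1, hr1⟩ : Fin m))) := by
            ext s
            simp only [Finset.mem_filter, Finset.mem_insert, Finset.mem_univ, true_and, Fin.lt_def,
              Fin.ext_iff]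
            omega
          rw [blkLo, this, Finset.sum_insert (by simp)]
          rw [blkLo] at h1
          omega
      by_contra! h2
      exact h r ⟨hlo, h2⟩
  rcases Nat.eq_zero_or_pos m with rfl | hm
  · simp at hN
    exact absurd j.2 (by omega)
  · have h1 := key ⟨m - 1, by omega⟩
    have : (Finset.univ : Finset (Fin m)) = insert ⟨m - 1, by omega⟩
        (Finset.univ.filter (fun s => s < (⟨m - 1, by omega⟩ : Fin m))) := by
      ext s
      have := s.2
      simp only [Finset.mem_filter, Finset.mem_insert, Finset.mem_univ, true_and, Fin.lt_def,
        Fin.ext_iff, true_iff]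
      omega
    rw [this, Finset.sum_insert (by simp)] at hN
    rw [blkLo] at h1
    have := j.2
    omega

theorem blkLo_add_le {m : ℕ} (Nr : Fin m → ℕ) {r s : Fin m} (h : r < s) :
    blkLo Nr r + Nr r ≤ blkLo Nr s := by
  have : blkLo Nr r + Nr r =
      ∑ t ∈ insert r (Finset.univ.filter (fun t => t < r)), Nr t := by
    rw [Finset.sum_insert (by simp), blkLo, add_comm]
  rw [this]
  refine Finset.sum_le_sum_of_subset fun t ht => ?_
  simp only [Finset.mem_insert, Finset.mem_filter, Finset.mem_univ, true_and] at ht ⊢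
  rcases ht with rfl | ht
  exacts [h, ht.trans h]

theorem inBlk_unique {m : ℕ} {Nr : Fin m → ℕ} {N : ℕ} {j : Fin N} {r s : Fin m}
    (hr : inBlk Nr r j) (hs : inBlk Nr s j) : r = s := by
  rcases lt_trichotomy r s with h | h | h
  · have := blkLo_add_le Nr h
    have := hr.2
    have := hs.1
    omega
  · exact h
  · have := blkLo_add_le Nr h
    have := hs.2
    have := hr.1
    omega

theorem card_inBlk_le {m : ℕ} (Nr : Fin m → ℕ) {N : ℕ} (r : Fin m) (s : Finset (Fin N))
    (hs : ∀ j ∈ s, inBlk Nr r j) : s.card ≤ Nr r := by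
  have h := Finset.card_le_card_of_injOn (s := s)
    (t := Finset.Ico (blkLo Nr r) (blkLo Nr r + Nr r)) (fun j => (j : ℕ))
    (fun j hj => by simpa [inBlk] using hs j hj) (fun _ _ _ _ h => Fin.ext h)
  simpa using h

theorem PsiFun_le {H : ℂ → ℂ → ℝ} {Z : Finset ℂ} {α : ℂ → ℝ} (hα : ∀ p ∈ Z, 0 ≤ α p) {N : ℕ}
    {ξ q : Fin N → ℂ} (hq : ∀ j, q j ∈ Z)
    (hcard : ∀ j, ((Finset.univ.filter fun k => q j = q k).card : ℝ) ≤ 1 + α (q j))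
    {L : Fin N → ℝ} (hL : ∀ j, 0 ≤ L j) {A B E : ℝ} (hE : 0 ≤ E)
    (hdiag : ∀ j, H (ξ j) (ξ j) ≤ B)
    (hsing : ∀ j, ∀ p ∈ Z, -A + (if p = q j then L j else 0) ≤ green H (ξ j) p)
    (hpair : ∀ j k, j ≠ k →
      green H (ξ j) (ξ k) ≤ E + if q j = q k then (L j + L k) / 2 else 0) :
    PsiFun H Z α ξ ≤
      1 / 2 * (N * B) + ∑ p ∈ Z, α p / 2 * (N * A) + 1 / 2 * (N * (N * E)) := by
  have h1 : ∑ j, H (ξ j) (ξ j) ≤ N * B := by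
    simpa using Finset.sum_le_sum fun j (_ : j ∈ Finset.univ) => hdiag j
  have h2 : ∑ j, α (q j) / 2 * L j - ∑ p ∈ Z, α p / 2 * (N * A) ≤
      ∑ p ∈ Z, α p / 2 * ∑ j, green H (ξ j) p := by
    have : ∑ j, α (q j) / 2 * L j = ∑ p ∈ Z, α p / 2 * ∑ j, if p = q j then L j else 0 := by
      simp_rw [Finset.mul_sum]
      rw [Finset.sum_comm]
      refine Finset.sum_congr rfl fun j _ => ?_
      simp_rw [mul_ite, mul_zero]
      rw [Finset.sum_ite_eq' Z (q j) (fun p => α p / 2 * L j), if_pos (hq j)]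
    rw [this, ← Finset.sum_sub_distrib]
    refine Finset.sum_le_sum fun p hp => ?_
    rw [← mul_sub]
    refine mul_le_mul_of_nonneg_left ?_ (div_nonneg (hα p hp) two_pos.le)
    have := Finset.sum_le_sum fun j (_ : j ∈ Finset.univ) => hsing j p hp
    simp only [Finset.sum_add_distrib, Finset.sum_const, Finset.card_univ, Fintype.card_fin,
      nsmul_eq_mul] at this
    linarith
  have h3 : (∑ j, ∑ k, if j ≠ k then green H (ξ j) (ξ k) else 0) ≤
      N * (N * E) + ∑ j, α (q j) * L j := by
    have hterm : ∀ j k, (if j ≠ k then green H (ξ j) (ξ k) else 0) ≤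
        E + ((if q j = q k then (L j + L k) / 2 else 0) - if j = k then L j else 0) := by
      intro j k
      by_cases h : j = k
      · subst h
        simpa using hE
      · simpa [h] using hpair j k h
    refine (Finset.sum_le_sum fun j _ => Finset.sum_le_sum fun k _ => hterm j k).trans ?_
    simp only [Finset.sum_add_distrib, Finset.sum_sub_distrib, Finset.sum_const, Finset.card_univ,
      Fintype.card_fin, nsmul_eq_mul, Finset.sum_ite_eq, Finset.mem_univ, if_true]
    gcongr
    have hsplit : (∑ j, ∑ k, if q j = q k then (L j + L k) / 2 else 0) =
        ∑ j, ∑ k, if q j = q k then L j else 0 := by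
      have hswap : (∑ j, ∑ k, if q j = q k then L k else 0) =
          ∑ j, ∑ k, if q j = q k then L j else 0 := by
        rw [Finset.sum_comm]
        simp_rw [eq_comm]
      have : (∑ j, ∑ k, if q j = q k then (L j + L k) / 2 else 0) =
          ((∑ j, ∑ k, if q j = q k then L j else 0) +
            ∑ j, ∑ k, if q j = q k then L k else 0) / 2 := by
        rw [← Finset.sum_add_distrib, Finset.sum_div]
        refine Finset.sum_congr rfl fun j _ => ?_
        rw [← Finset.sum_add_distrib, Finset.sum_div]
        refine Finset.sum_congr rfl fun k _ => ?_
        split_ifs <;> simp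
      rw [this, hswap]
      ring
    rw [hsplit, ← Finset.sum_sub_distrib]
    refine Finset.sum_le_sum fun j _ => ?_
    rw [← Finset.sum_filter, Finset.sum_const, nsmul_eq_mul]
    nlinarith [hcard j, hL j]
  have h4 : ∑ j, α (q j) * L j = 2 * ∑ j, α (q j) / 2 * L j := by
    rw [Finset.mul_sum]
    exact Finset.sum_congr rfl fun j _ => by ring
  rw [PsiFun]
  linarith

theorem le_diag_sub_sing {H : ℂ → ℂ → ℝ} {Z : Finset ℂ} {α : ℂ → ℝ} (hα : ∀ p ∈ Z, 0 ≤ α p)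
    {N : ℕ} {ξ : Fin N → ℂ} {A B : ℝ} (hdiag : ∀ j, -B ≤ H (ξ j) (ξ j))
    (hsing : ∀ j, ∀ p ∈ Z, green H (ξ j) p ≤ A) :
    -(1 / 2 * (N * B) + ∑ p ∈ Z, α p / 2 * (N * A)) ≤
      (1 / 2) * ∑ j, H (ξ j) (ξ j) - ∑ p ∈ Z, (α p / 2) * ∑ j, green H (ξ j) p := by
  have h1 : N * -B ≤ ∑ j, H (ξ j) (ξ j) := by
    simpa using Finset.sum_le_sum fun j (_ : j ∈ Finset.univ) => hdiag j
  have h2 : ∑ p ∈ Z, α p / 2 * ∑ j, green H (ξ j) p ≤ ∑ p ∈ Z, α p / 2 * (N * A) := by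
    refine Finset.sum_le_sum fun p hp => ?_
    refine mul_le_mul_of_nonneg_left ?_ (div_nonneg (hα p hp) two_pos.le)
    simpa using Finset.sum_le_sum fun j (_ : j ∈ Finset.univ) => hsing j p hp
  linarith

theorem sum_offDiag_le {N : ℕ} {F : Fin N → Fin N → ℝ} {E : ℝ} (hE : 0 ≤ E)
    (hF : ∀ j k, j ≠ k → F j k ≤ E) :
    (∑ j, ∑ k, if j ≠ k then F j k else 0) ≤ N * (N * E) := by
  have hterm : ∀ j k, (if j ≠ k then F j k else 0) ≤ E := by
    intro j k
    split_ifs with h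
    exacts [hF j k h, hE]
  simpa using Finset.sum_le_sum fun j (_ : j ∈ Finset.univ) =>
    Finset.sum_le_sum fun k (_ : k ∈ Finset.univ) => hterm j k

theorem le_PsiFun {H : ℂ → ℂ → ℝ} {Z : Finset ℂ} {α : ℂ → ℝ} (hα : ∀ p ∈ Z, 0 ≤ α p) {N : ℕ}
    {ξ : Fin N → ℂ} {A B E : ℝ} (hE : 0 ≤ E) (hdiag : ∀ j, -B ≤ H (ξ j) (ξ j))
    (hsing : ∀ j, ∀ p ∈ Z, green H (ξ j) p ≤ A)
    (hpair : ∀ j k, j ≠ k → -E ≤ green H (ξ j) (ξ k)) :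
    -(1 / 2 * (N * B) + ∑ p ∈ Z, α p / 2 * (N * A) + 1 / 2 * (N * (N * E))) ≤
      PsiFun H Z α ξ := by
  have h1 := le_diag_sub_sing hα hdiag hsing
  have h2 := sum_offDiag_le hE fun j k h => neg_le.1 (hpair j k h)
  have h3 : (∑ j, ∑ k, if j ≠ k then -green H (ξ j) (ξ k) else 0) =
      -∑ j, ∑ k, if j ≠ k then green H (ξ j) (ξ k) else 0 := by
    simp_rw [← Finset.sum_neg_distrib]
    refine Finset.sum_congr rfl fun j _ => Finset.sum_congr rfl fun k _ => ?_
    split_ifs <;> simp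
  rw [PsiFun]
  linarith

theorem le_PhiFun {H : ℂ → ℂ → ℝ} {Z : Finset ℂ} {α : ℂ → ℝ} (hα : ∀ p ∈ Z, 0 ≤ α p) {N : ℕ}
    {ξ : Fin N → ℂ} {A B E : ℝ} (hE : 0 ≤ E) (hdiag : ∀ j, -B ≤ H (ξ j) (ξ j))
    (hsing : ∀ j, ∀ p ∈ Z, green H (ξ j) p ≤ A)
    (hpair : ∀ j k, j ≠ k → green H (ξ j) (ξ k) ≤ E) :
    -(1 / 2 * (N * B) + ∑ p ∈ Z, α p / 2 * (N * A) + 1 / 2 * (N * (N * E))) ≤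
      PhiFun H Z α ξ := by
  have h1 := le_diag_sub_sing hα hdiag hsing
  have h2 := sum_offDiag_le hE hpair
  rw [PhiFun]
  linarith

theorem mul_le_norm_sub_sq (p : ℂ) (ρ σ a b : ℝ) :
    ρ * σ * (2 * (1 - Real.cos (a - b))) ≤
      ‖(p + ρ * Complex.exp (a * Complex.I)) - (p + σ * Complex.exp (b * Complex.I))‖ ^ 2 := by
  rw [← Complex.normSq_eq_norm_sq, Complex.normSq_apply]
  simp only [Complex.exp_ofReal_mul_I_re, Complex.exp_ofReal_mul_I_im, Complex.sub_re,
    Complex.sub_im, Complex.add_re, Complex.add_im, Complex.mul_re, Complex.mul_im,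
    Complex.ofReal_re, Complex.ofReal_im]
  rw [Real.cos_sub]
  linear_combination sq_nonneg (ρ - σ) - ρ ^ 2 * Real.sin_sq_add_cos_sq a -
    σ ^ 2 * Real.sin_sq_add_cos_sq b

/-- The point with polar coordinates `(ρ, a)` centred at `p`. -/
noncomputable def polarPt (p : ℂ) (ρ a : ℝ) : ℂ := p + ρ * Complex.exp (a * Complex.I)

theorem norm_polarPt_sub (p : ℂ) {ρ : ℝ} (hρ : 0 ≤ ρ) (a : ℝ) : ‖polarPt p ρ a - p‖ = ρ := by
  rw [polarPt, add_sub_cancel_left, norm_mul, Complex.norm_exp_ofReal_mul_I, mul_one,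
    Complex.norm_real, Real.norm_of_nonneg hρ]

theorem continuous_polarPt {X : Type*} [TopologicalSpace X] (p : ℂ) {ρ a : X → ℝ}
    (hρ : Continuous ρ) (ha : Continuous a) : Continuous fun x => polarPt p (ρ x) (a x) := by
  unfold polarPt
  fun_prop

theorem polarPt_ne {p : ℂ} {ρ σ a b : ℝ} (hρ : 0 < ρ) (hσ : 0 < σ) (h : Real.cos (a - b) < 1) :
    polarPt p ρ a ≠ polarPt p σ b := by
  intro heq
  have h1 := mul_le_norm_sub_sq p ρ σ a b
  rw [← polarPt, ← polarPt, heq, sub_self, norm_zero] at h1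
  have h2 : 0 < ρ * σ * (2 * (1 - Real.cos (a - b))) := by
    have := sub_pos.2 h
    positivity
  linarith

/-- The torus of configurations whose `j`-th point lies on the circle of radius `ρ j` about
`q j`. -/
noncomputable def torusPt {N : ℕ} (q : Fin N → ℂ) (ρ : Fin N → ℝ) (x : Fin N → ℝ) : Fin N → ℂ :=
  fun j => polarPt (q j) (ρ j) (2 * π * x j)

theorem continuous_torusPt {N : ℕ} (q : Fin N → ℂ) (ρ : Fin N → ℝ) : Continuous (torusPt q ρ) :=
  continuous_pi fun j => continuous_polarPt _ continuous_const (by fun_prop)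

theorem intPeriodic_torusPt {N : ℕ} (q : Fin N → ℂ) (ρ : Fin N → ℝ) :
    IntPeriodic (torusPt q ρ) := by
  intro k x
  funext j
  simp only [torusPt, polarPt, Pi.add_apply]
  congr 2
  rw [Complex.exp_eq_exp_iff_exists_int]
  exact ⟨k j, by push_cast; ring⟩

/-- A homotopy from the identity that avoids the centres cannot push the torus of configurations
off a product of rays. -/
theorem exists_torusPt_mem_rays {N : ℕ} {q : Fin N → ℂ} {ρ : Fin N → ℝ} (hρ : ∀ j, 0 < ρ j)
    {K : Set (Fin N → ℂ)} (hK : ∀ x, torusPt q ρ x ∈ K) {Γ : ℝ × (Fin N → ℂ) → Fin N → ℂ}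
    (hΓ : ContinuousOn Γ (Icc (0 : ℝ) 1 ×ˢ K)) (hΓ0 : ∀ ξ ∈ K, Γ (0, ξ) = ξ)
    (hne : ∀ t ∈ Icc (0 : ℝ) 1, ∀ ξ ∈ K, ∀ j, Γ (t, ξ) j ≠ q j) (β : Fin N → ℝ) :
    ∃ x, ∀ j, ∃ c : ℝ, 0 < c ∧ Γ (1, torusPt q ρ x) j = polarPt (q j) c (β j) := by
  have key : ∀ j, ∃ f : (Fin N → ℝ) → ℝ, Continuous f ∧ IntPeriodic f ∧ ∀ x, ∃ c : ℝ, 0 < c ∧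
      Γ (1, torusPt q ρ x) j - q j = c * ((Γ (0, torusPt q ρ x) j - q j) *
        Complex.exp (((2 * π * f x : ℝ) : ℂ) * Complex.I)) := by
    intro j
    refine exists_intPeriodic_angle (g := fun z => Γ (z.1, torusPt q ρ z.2) j - q j) ?_ ?_ ?_
    · have h1 : ContinuousOn (fun z : ℝ × (Fin N → ℝ) => Γ (z.1, torusPt q ρ z.2))
          (Icc (0 : ℝ) 1 ×ˢ univ) :=
        hΓ.comp (continuous_fst.prodMk ((continuous_torusPt q ρ).comp continuous_snd)).continuousOn
          fun z hz => ⟨hz.1, hK z.2⟩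
      exact (continuousOn_pi.1 h1 j).sub continuousOn_const
    · exact fun t ht x => sub_ne_zero.2 (hne t ht _ (hK x) j)
    · intro t _ k x
      simp only [show torusPt q ρ (x + fun i => (k i : ℝ)) = torusPt q ρ x from
        intPeriodic_torusPt q ρ k x]
  choose f hfc hfp hf using key
  have hper : IntPeriodic fun x j => f j x := fun k x => funext fun j => hfp j k x
  obtain ⟨x, hx⟩ := hper.surjective_id_add (continuous_pi hfc) fun j => β j / (2 * π)
  refine ⟨x, fun j => ?_⟩
  obtain ⟨c, hc, hcx⟩ := hf j x
  refine ⟨c * ρ j, mul_pos hc (hρ j), ?_⟩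
  have hβ : β j = 2 * π * x j + 2 * π * f j x := by
    have := congrFun hx j
    simp only [Pi.add_apply] at this
    rw [← mul_add, this]
    field_simp
  rw [hΓ0 _ (hK x)] at hcx
  rw [torusPt, polarPt, add_sub_cancel_left, mul_assoc, ← Complex.exp_add, ← add_mul,
    ← Complex.ofReal_add, ← hβ, sub_eq_iff_eq_add'] at hcx
  rw [hcx, polarPt, Complex.ofReal_mul, mul_assoc]

theorem exists_pos_forall_le {ι : Type*} [Finite ι] {R : ι → Prop} {F : ι → ℝ}
    (h : ∀ i, R i → 0 < F i) : ∃ d : ℝ, 0 < d ∧ ∀ i, R i → d ≤ F i := by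
  have h1 : ∀ᶠ d in nhdsWithin (0 : ℝ) (Ioi 0), ∀ i, R i → d ≤ F i := by
    refine eventually_all.2 fun i => ?_
    by_cases hi : R i
    · filter_upwards [Ioo_mem_nhdsGT (h i hi)] with d hd _ using hd.2.le
    · exact Eventually.of_forall fun _ h => absurd h hi
  obtain ⟨d, hd, hd0⟩ := (h1.and self_mem_nhdsWithin).exists
  exact ⟨d, hd0, hd⟩

theorem IsCompact.exists_forall_le_norm_sub {N : ℕ} {S : Set (Fin N → ℂ)} (hS : IsCompact S)
    {R : Fin N → Fin N → Prop} (h : ∀ ξ ∈ S, ∀ j k, R j k → ξ j ≠ ξ k) :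
    ∃ d : ℝ, 0 < d ∧ ∀ ξ ∈ S, ∀ j k, R j k → d ≤ ‖ξ j - ξ k‖ := by
  rcases S.eq_empty_or_nonempty with rfl | hne
  · exact ⟨1, one_pos, by simp⟩
  have hmin : ∀ i : Fin N × Fin N, ∃ η ∈ S, ∀ ξ ∈ S, ‖η i.1 - η i.2‖ ≤ ‖ξ i.1 - ξ i.2‖ :=
    fun i => hS.exists_isMinOn hne (f := fun ξ => ‖ξ i.1 - ξ i.2‖) (by fun_prop)
  choose η hη hle using hmin
  obtain ⟨d, hd, hdF⟩ := exists_pos_forall_le (ι := Fin N × Fin N) (R := fun i => R i.1 i.2)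
    (F := fun i => ‖η i i.1 - η i i.2‖)
    fun i hi => norm_pos_iff.2 (sub_ne_zero.2 (h _ (hη i) _ _ hi))
  exact ⟨d, hd, fun ξ hξ j k hjk => (hdF (j, k) hjk).trans (hle (j, k) ξ hξ)⟩

/-- Configurations whose `j`-th point lies in the annulus about `q j`, pairwise separated. -/
def sepAnnuli {N : ℕ} (δ : ℝ) (q : Fin N → ℂ) (M : ℝ) : Set (Fin N → ℂ) :=
  {ξ | (∀ j, ξ j ∈ annU δ (q j)) ∧ ∀ j k, j ≠ k → M⁻¹ < ‖ξ j - ξ k‖}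

/-- The starting configuration and a suitable torus of configurations lie in one component. -/
theorem exists_torusPt_mem_connectedComponentIn {N : ℕ} {δ : ℝ} (hδ : 0 < δ) {q : Fin N → ℂ}
    (hq : ∀ j k, q j ≠ q k → 4 * δ < ‖q j - q k‖) {β : Fin N → ℝ}
    (hβ : ∀ j k, j ≠ k → q j = q k → Real.cos (β j - β k) < 1) :
    ∃ ρ : Fin N → ℝ, (∀ j, 0 < ρ j) ∧ ∀ᶠ M in atTop,
      (fun j => polarPt (q j) (3 / 2 * δ) (β j)) ∈ sepAnnuli δ q M ∧
      ∀ x, torusPt q ρ x ∈ connectedComponentIn (sepAnnuli δ q M)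
        (fun j => polarPt (q j) (3 / 2 * δ) (β j)) := by
  set ρ : Fin N → ℝ := fun j => δ * (1 + ((j : ℕ) + 1) / (N + 1)) with hρdef
  have hρ : ∀ j, δ < ρ j ∧ ρ j < 2 * δ := by
    intro j
    have h1 : (0 : ℝ) < ((j : ℕ) + 1) / (N + 1) := by positivity
    have h2 : (((j : ℕ) : ℝ) + 1) / (N + 1) < 1 := by
      rw [div_lt_one (by positivity)]
      have : ((j : ℕ) : ℝ) < N := by exact_mod_cast j.2
      linarith
    constructor <;> simp only [hρdef] <;> nlinarith
  have hρinj : Function.Injective ρ := by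
    intro j k h
    simp only [hρdef] at h
    have h1 := mul_left_cancel₀ hδ.ne' h
    have h2 : (N : ℝ) + 1 ≠ 0 := by positivity
    field_simp at h1
    have h3 : ((j : ℕ) : ℝ) = (k : ℕ) := by linarith
    exact Fin.ext (by exact_mod_cast h3)
  set path : ℝ → Fin N → ℂ := fun s j =>
    polarPt (q j) ((1 - s) * (3 / 2 * δ) + s * ρ j) (β j) with hpath
  have hpc : Continuous path :=
    continuous_pi fun j => continuous_polarPt _ (by fun_prop) continuous_const
  have hrad : ∀ s ∈ Icc (0 : ℝ) 1, ∀ j, δ < (1 - s) * (3 / 2 * δ) + s * ρ j ∧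
      (1 - s) * (3 / 2 * δ) + s * ρ j < 2 * δ := by
    rintro s ⟨hs0, hs1⟩ j
    obtain ⟨h1, h2⟩ := hρ j
    have := convex_Ioo δ (2 * δ) (x := 3 / 2 * δ) ⟨by linarith, by linarith⟩ (y := ρ j) ⟨h1, h2⟩
      (sub_nonneg.2 hs1) hs0 (by ring)
    simpa using this
  set S : Set (Fin N → ℂ) := path '' Icc 0 1 ∪ torusPt q ρ '' Icc 0 1 with hS
  have hScpt : IsCompact S := (isCompact_Icc.image hpc).union
    (isCompact_Icc.image (continuous_torusPt q ρ))
  have hann : ∀ ξ ∈ S, ∀ j, ξ j ∈ annU δ (q j) := by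
    rintro ξ (⟨s, hs, rfl⟩ | ⟨x, -, rfl⟩) j
    · have := hrad s hs j
      rwa [annU, Set.mem_ofPred_eq, norm_polarPt_sub _ (hδ.le.trans this.1.le)]
    · rw [annU, Set.mem_ofPred_eq, torusPt, norm_polarPt_sub _ (hδ.le.trans (hρ j).1.le)]
      exact hρ j
  have hinj : ∀ ξ ∈ S, ∀ j k, j ≠ k → ξ j ≠ ξ k := by
    intro ξ hξ j k hjk heq
    by_cases hqq : q j = q k
    · rcases hξ with ⟨s, hs, rfl⟩ | ⟨x, -, rfl⟩
      · simp only [hpath, hqq] at heq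
        exact polarPt_ne (hδ.trans (hrad s hs j).1) (hδ.trans (hrad s hs k).1) (hβ j k hjk hqq) heq
      · have h1 := norm_polarPt_sub (q j) (hδ.le.trans (hρ j).1.le) (2 * π * x j)
        have h2 := norm_polarPt_sub (q k) (hδ.le.trans (hρ k).1.le) (2 * π * x k)
        simp only [torusPt] at heq
        rw [heq, hqq, h2] at h1
        exact hjk (hρinj h1.symm)
    · have h1 := (hann ξ hξ j).2
      have h2 := (hann ξ hξ k).2
      rw [heq, norm_sub_rev] at h1
      have := norm_sub_le_norm_sub_add_norm_sub (q j) (ξ k) (q k)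
      linarith [hq j k hqq]
  obtain ⟨d, hd, hdS⟩ := hScpt.exists_forall_le_norm_sub (R := fun j k => j ≠ k) hinj
  have hmem0 : (fun j => polarPt (q j) (3 / 2 * δ) (β j)) ∈ S :=
    Or.inl ⟨0, by simp, by simp [hpath]⟩
  have hpre : IsPreconnected S := by
    refine IsPreconnected.union' ?_ (isPreconnected_Icc.image _ hpc.continuousOn)
      ((convex_Icc _ _).isPreconnected.image _ (continuous_torusPt q ρ).continuousOn)
    obtain ⟨y, hy, hyx⟩ := (intPeriodic_torusPt q ρ).exists_mem_Icc fun j => β j / (2 * π)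
    refine ⟨path 1, ⟨1, by simp, rfl⟩, y, hy, ?_⟩
    rw [hyx]
    funext j
    simp only [torusPt, hpath, sub_self, zero_mul, zero_add, one_mul]
    congr 1
    field_simp
  refine ⟨ρ, fun j => hδ.trans (hρ j).1, ?_⟩
  filter_upwards [tendsto_inv_atTop_zero.eventually_lt_const hd] with M hM
  have hsub : S ⊆ sepAnnuli δ q M := fun ξ hξ =>
    ⟨hann ξ hξ, fun j k hjk => hM.trans_le (hdS ξ hξ j k hjk)⟩
  refine ⟨hsub hmem0, fun x => hpre.subset_connectedComponentIn hmem0 hsub (Or.inr ?_)⟩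
  obtain ⟨y, hy, hyx⟩ := (intPeriodic_torusPt q ρ).exists_mem_Icc x
  exact ⟨y, hy, hyx⟩

theorem green_eq (H : ℂ → ℂ → ℝ) (x y : ℂ) :
    green H x y = -(1 / (2 * π) * Real.log ‖x - y‖) + H x y := by
  rw [green, one_div ‖x - y‖, Real.log_inv, mul_neg]

theorem green_le {H : ℂ → ℂ → ℝ} {x y : ℂ} {d A : ℝ} (hd : 0 < d) (hxy : d ≤ ‖x - y‖)
    (hA : H x y ≤ A) : green H x y ≤ -(1 / (2 * π) * Real.log d) + A := by
  rw [green_eq]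
  have := Real.log_le_log hd hxy
  gcongr

theorem le_green {H : ℂ → ℂ → ℝ} {x y : ℂ} {D A : ℝ} (hD : 1 ≤ D) (hxy : ‖x - y‖ ≤ D)
    (hA : -A ≤ H x y) : -(1 / (2 * π) * Real.log D + A) ≤ green H x y := by
  rw [green_eq, neg_add]
  have : Real.log ‖x - y‖ ≤ Real.log D := by
    rcases (norm_nonneg (x - y)).eq_or_lt with h | h
    · rw [← h, Real.log_zero]
      exact Real.log_nonneg hD
    · exact Real.log_le_log h hxy
  gcongr

/-- A bounded domain together with two-sided bounds for the regular part: an upper bound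
everywhere, and a lower bound near the points of `Z`. -/
structure RegPartBounds (Ω : Set ℂ) (H : ℂ → ℂ → ℝ) (Z : Finset ℂ) (δ D A : ℝ) : Prop where
  one_le : 1 ≤ D
  nonneg : 0 ≤ A
  norm_sub_le : ∀ x ∈ Ω, ∀ y ∈ Ω, ‖x - y‖ ≤ D
  le : ∀ x ∈ Ω, ∀ y ∈ Ω, H x y ≤ A
  mem : ∀ p ∈ Z, ∀ x, ‖x - p‖ ≤ 2 * δ → x ∈ Ω
  neg_le : ∀ p ∈ Z, ∀ x, ‖x - p‖ ≤ 2 * δ → ∀ y ∈ Ω, -A ≤ H x y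

theorem RegPart.exists_bounds {Ω : Set ℂ} (hΩo : IsOpen Ω) (hΩb : Bornology.IsBounded Ω)
    {H : ℂ → ℂ → ℝ} (hH : RegPart Ω H) {Z : Finset ℂ} (hZ : (Z : Set ℂ) ⊆ Ω) {δ : ℝ}
    (hδ : 0 ≤ δ) (hdist : ∀ p ∈ Z, 2 * δ < Metric.infDist p (frontier Ω)) :
    ∃ D A, RegPartBounds Ω H Z δ D A := by
  obtain ⟨R, hR⟩ := hΩb.closure.exists_norm_le
  obtain ⟨d, hd, hdZ⟩ := exists_pos_forall_le (ι := Z) (R := fun _ => True)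
    (F := fun p => Metric.infDist (p : ℂ) (frontier Ω) - 2 * δ)
    fun p _ => sub_pos.2 (hdist p p.2)
  set D := max 1 (2 * R)
  set A := max 0 (max (1 / (2 * π) * Real.log D) (-(1 / (2 * π) * Real.log d)))
  have hnorm : ∀ x ∈ Ω, ∀ y ∈ closure Ω, ‖x - y‖ ≤ D := fun x hx y hy =>
    (norm_sub_le x y).trans <| by
      have := hR x (subset_closure hx)
      have := hR y hy
      exact le_max_of_le_right (by linarith)
  have hfar : ∀ p ∈ Z, ∀ x, ‖x - p‖ ≤ 2 * δ → ∀ y ∈ frontier Ω, d ≤ ‖x - y‖ := by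
    intro p hp x hx y hy
    have h1 := hdZ ⟨p, hp⟩ trivial
    have h2 := Metric.infDist_le_dist_of_mem (x := p) hy
    have h3 := dist_triangle p x y
    rw [dist_comm p x, dist_eq_norm x p, dist_eq_norm x y] at h3
    simp only at h1
    linarith
  have hmem : ∀ p ∈ Z, ∀ x, ‖x - p‖ ≤ 2 * δ → x ∈ Ω := by
    intro p hp x hx
    have hsub : Metric.closedBall p (2 * δ) ⊆ Ω ∪ (closure Ω)ᶜ := by
      intro y hy
      by_contra! h
      simp only [mem_union, mem_compl_iff, not_or, not_not] at h
      have := hfar p hp y (by simpa [dist_eq_norm] using hy) y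
        (by rw [hΩo.frontier_eq]; exact ⟨h.2, h.1⟩)
      rw [sub_self, norm_zero] at this
      linarith
    exact (convex_closedBall p _).isPreconnected.subset_left_of_subset_union hΩo
      isClosed_closure.isOpen_compl
      (disjoint_compl_right.mono_left subset_closure) hsub
      ⟨p, Metric.mem_closedBall_self (by linarith), hZ hp⟩ (by simpa [dist_eq_norm] using hx)
  refine ⟨D, A, le_max_left _ _, le_max_left _ _,
    fun x hx y hy => hnorm x hx y (subset_closure hy), fun x hx y hy => ?_, hmem,
    fun p hp x hx y hy => ?_⟩
  · exact (hH.le_log hΩo hΩb hx (fun z hz => hnorm x hx z hz.1) hy).trans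
      ((le_max_left _ _).trans (le_max_right _ _))
  · refine le_trans ?_ (hH.log_le hΩo hΩb hd (hmem p hp x hx) (hfar p hp x hx) hy)
    exact neg_le.1 ((le_max_right _ _).trans (le_max_right _ _))

/-- `Ψ` is bounded above on configurations whose points lie on prescribed rays. -/
theorem RegPartBounds.exists_PsiFun_le {Ω : Set ℂ} {H : ℂ → ℂ → ℝ} {Z : Finset ℂ} {δ D A : ℝ}
    (hb : RegPartBounds Ω H Z δ D A) (hδ : 0 ≤ δ) (hsymm : ∀ x ∈ Ω, ∀ y ∈ Ω, H x y = H y x)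
    {α : ℂ → ℝ} (hα : ∀ p ∈ Z, 0 ≤ α p) {N : ℕ} {q : Fin N → ℂ} (hq : ∀ j, q j ∈ Z)
    (hcard : ∀ j, ((Finset.univ.filter fun k => q j = q k).card : ℝ) ≤ 1 + α (q j))
    {β : Fin N → ℝ} (hβ : ∀ j k, j ≠ k → q j = q k → Real.cos (β j - β k) < 1)
    (hrays : ∀ j k, q j ≠ q k → ∀ ρ σ : ℝ, 0 ≤ ρ → 0 ≤ σ →
      polarPt (q j) ρ (β j) ≠ polarPt (q k) σ (β k)) :
    ∃ C, ∀ ξ : Fin N → ℂ, (∀ j, ξ j ∈ Ω) →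
      (∀ j, ∃ c : ℝ, 0 < c ∧ ξ j = polarPt (q j) c (β j)) → PsiFun H Z α ξ ≤ C := by
  have hZΩ : ∀ p ∈ Z, p ∈ Ω := fun p hp => hb.mem p hp p (by simpa using hδ)
  obtain ⟨a, ha, haβ⟩ := exists_pos_forall_le (ι := Fin N × Fin N)
    (R := fun i => i.1 ≠ i.2 ∧ q i.1 = q i.2)
    (F := fun i => 2 * (1 - Real.cos (β i.1 - β i.2)))
    fun i hi => mul_pos two_pos (sub_pos.2 (hβ _ _ hi.1 hi.2))
  have hS : IsCompact ((fun (c : Fin N → ℝ) j => polarPt (q j) (c j) (β j)) ''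
      Icc 0 (fun _ => D)) := isCompact_Icc.image <| continuous_pi fun j =>
    continuous_polarPt _ (continuous_apply j) continuous_const
  obtain ⟨d, hd, hdS⟩ := hS.exists_forall_le_norm_sub (R := fun j k => q j ≠ q k) <| by
    rintro _ ⟨c, hc, rfl⟩ j k hjk
    exact hrays j k hjk _ _ (hc.1 j) (hc.1 k)
  set κ : ℝ := 1 / (2 * π) with hκ
  have hκ0 : 0 < κ := by positivity
  set E : ℝ := |κ * Real.log d| + |κ * Real.log D| + |κ * Real.log a| + A with hE
  have hA := hb.nonneg
  refine ⟨1 / 2 * (N * A) + ∑ p ∈ Z, α p / 2 * (N * (κ * Real.log D + A)) +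
    1 / 2 * (N * (N * E)), fun ξ hξΩ hξ => ?_⟩
  choose c hc hcξ using hξ
  have hnorm : ∀ j, ‖ξ j - q j‖ = c j := fun j => by
    rw [hcξ, norm_polarPt_sub _ (hc j).le]
  have hcD : ∀ j, c j ≤ D := fun j =>
    hnorm j ▸ hb.norm_sub_le _ (hξΩ j) _ (hZΩ _ (hq j))
  refine PsiFun_le (A := κ * Real.log D + A) (B := A) (E := E)
    (L := fun j => κ * (Real.log D - Real.log (c j))) hα hq hcard (fun j => ?_) (by positivity)
    (fun j => hb.le _ (hξΩ j) _ (hξΩ j)) (fun j p hp => ?_) (fun j k hjk => ?_)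
  · exact mul_nonneg hκ0.le (sub_nonneg.2 (Real.log_le_log (hc j) (hcD j)))
  · have hH : -A ≤ H (ξ j) p := by
      rw [hsymm _ (hξΩ j) _ (hZΩ p hp)]
      exact hb.neg_le p hp p (by simpa using hδ) _ (hξΩ j)
    split_ifs with h
    · subst h
      rw [green_eq, hnorm]
      simp only [← hκ]
      linarith
    · rw [add_zero]
      exact le_green hb.one_le (hb.norm_sub_le _ (hξΩ j) _ (hZΩ p hp)) hH
  · have hH := hb.le _ (hξΩ j) _ (hξΩ k)
    have hd1 := neg_abs_le (κ * Real.log d)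
    have hD1 := neg_abs_le (κ * Real.log D)
    have ha1 := neg_abs_le (κ * Real.log a)
    have hd2 := abs_nonneg (κ * Real.log d)
    have hD2 := abs_nonneg (κ * Real.log D)
    have ha2 := abs_nonneg (κ * Real.log a)
    split_ifs with h
    · have h1 := mul_le_norm_sub_sq (q j) (c j) (c k) (β j) (β k)
      have h2 : c j * c k * a ≤ ‖ξ j - ξ k‖ ^ 2 := by
        rw [hcξ j, hcξ k, ← h]
        exact (mul_le_mul_of_nonneg_left (haβ (j, k) ⟨hjk, h⟩)
          (mul_pos (hc j) (hc k)).le).trans h1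
      have h3 := Real.log_le_log (mul_pos (mul_pos (hc j) (hc k)) ha) h2
      rw [Real.log_pow, Real.log_mul (mul_pos (hc j) (hc k)).ne' ha.ne',
        Real.log_mul (hc j).ne' (hc k).ne'] at h3
      have h4 := mul_le_mul_of_nonneg_left h3 hκ0.le
      rw [green_eq]
      simp only [← hκ, hE]
      push_cast at h4
      linarith
    · have h1 : d ≤ ‖ξ j - ξ k‖ := by
        have := hdS _ ⟨c, ⟨fun j => (hc j).le, hcD⟩, rfl⟩ j k h
        rwa [hcξ j, hcξ k]
      have h2 := green_le hd h1 hH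
      simp only [← hκ] at h2
      simp only [hE]
      linarith

theorem eventually_add_mul_log_lt (a b : ℝ) : ∀ᶠ M in atTop, a + b * Real.log M < M := by
  have h := (Real.isLittleO_log_id_atTop.const_mul_left b).add
    (Asymptotics.isLittleO_const_id_atTop a)
  filter_upwards [h.def (c := 1 / 2) (by norm_num), eventually_gt_atTop 0] with M hM hM0
  have := (le_abs_self _).trans hM
  rw [id, Real.norm_of_nonneg hM0.le] at this
  linarith

theorem closure_sepAnnuli_subset {N : ℕ} (δ : ℝ) (q : Fin N → ℂ) (M : ℝ) :
    closure (sepAnnuli δ q M) ⊆ {ξ | (∀ j, δ ≤ ‖ξ j - q j‖ ∧ ‖ξ j - q j‖ ≤ 2 * δ) ∧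
      ∀ j k, j ≠ k → M⁻¹ ≤ ‖ξ j - ξ k‖} := by
  refine closure_minimal (fun ξ hξ => ⟨fun j => ⟨(hξ.1 j).1.le, (hξ.1 j).2.le⟩,
    fun j k hjk => (hξ.2 j k hjk).le⟩) ?_
  simp only [ofPred_and, ofPred_forall]
  refine (isClosed_iInter fun j => IsClosed.inter ?_ ?_).inter
    (isClosed_iInter fun j => isClosed_iInter fun k => isClosed_iInter fun _ => ?_)
  · exact isClosed_le (by fun_prop) (by fun_prop)
  · exact isClosed_le (by fun_prop) (by fun_prop)
  · exact isClosed_le (by fun_prop) (by fun_prop)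

theorem RegPartBounds.closure_sepAnnuli {Ω : Set ℂ} {H : ℂ → ℂ → ℝ} {Z : Finset ℂ} {δ D A : ℝ}
    (hb : RegPartBounds Ω H Z δ D A) (hδ : 0 < δ)
    (hsep : ∀ p ∈ Z, ∀ q ∈ Z, p ≠ q → 4 * δ < ‖p - q‖)
    {α : ℂ → ℝ} (hα : ∀ p ∈ Z, 0 ≤ α p) {N : ℕ} {q : Fin N → ℂ} (hq : ∀ j, q j ∈ Z) :
    ∃ c, ∀ᶠ M in atTop, ∀ ξ ∈ closure (sepAnnuli δ q M),
      ξ ∈ Dset Ω H Z α M ∧ c ≤ PsiFun H Z α ξ := by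
  set A₁ : ℝ := -(1 / (2 * π) * Real.log δ) + A
  refine ⟨-(1 / 2 * (N * A) + ∑ p ∈ Z, α p / 2 * (N * A₁) +
    1 / 2 * (N * (N * (1 / (2 * π) * Real.log D + A)))), ?_⟩
  filter_upwards [eventually_ge_atTop 1, eventually_add_mul_log_lt
    (1 / 2 * (N * A) + ∑ p ∈ Z, α p / 2 * (N * A₁) + 1 / 2 * (N * (N * A)))
    (1 / 2 * (N * (N * (1 / (2 * π)))))] with M hM1 hM ξ hξ
  obtain ⟨hann, hpair⟩ := closure_sepAnnuli_subset δ q M hξ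
  have hM0 : 0 < M⁻¹ := inv_pos.2 (one_pos.trans_le hM1)
  have hΩ : ∀ j, ξ j ∈ Ω := fun j => hb.mem _ (hq j) _ (hann j).2
  have hZΩ : ∀ p ∈ Z, p ∈ Ω := fun p hp => hb.mem p hp p (by simpa using hδ.le)
  have hfar : ∀ j, ∀ p ∈ Z, δ ≤ ‖ξ j - p‖ := by
    intro j p hp
    by_cases h : q j = p
    · exact h ▸ (hann j).1
    · have h1 := hsep _ (hq j) p hp h
      have h2 := norm_sub_le_norm_sub_add_norm_sub (q j) (ξ j) p
      have h3 := (hann j).2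
      rw [norm_sub_rev] at h3
      linarith
  have hlow : ∀ j, ∀ y ∈ Ω, -A ≤ H (ξ j) y := fun j => hb.neg_le _ (hq j) _ (hann j).2
  have hsing : ∀ j, ∀ p ∈ Z, green H (ξ j) p ≤ A₁ := fun j p hp =>
    green_le hδ (hfar j p hp) (hb.le _ (hΩ j) _ (hZΩ p hp))
  have hA := hb.nonneg
  refine ⟨⟨⟨fun j => ⟨hΩ j, fun h => ?_⟩, fun j k h => ?_⟩, ?_⟩, ?_⟩
  · have := hfar j _ h
    rw [sub_self, norm_zero] at this
    linarith
  · by_contra hjk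
    have := hpair j k hjk
    rw [h, sub_self, norm_zero] at this
    linarith
  · refine lt_of_lt_of_le ?_ (le_PhiFun (A := A₁) (B := A) (E := 1 / (2 * π) * Real.log M + A) hα
      ?_ (fun j => hlow j _ (hΩ j)) hsing fun j k hjk => ?_)
    · rw [neg_lt_neg_iff]
      linarith
    · have := Real.log_nonneg hM1
      positivity
    · have := green_le hM0 (hpair j k hjk) (hb.le _ (hΩ j) _ (hΩ k))
      rwa [Real.log_inv, mul_neg, neg_neg] at this
  · have hlog := Real.log_nonneg hb.one_le
    exact le_PsiFun hα (by positivity) (fun j => hlow j _ (hΩ j)) hsing fun j k _ =>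
      le_green hb.one_le (hb.norm_sub_le _ (hΩ j) _ (hΩ k)) (hlow j _ (hΩ k))

/-- the max-min value Ψ*_M = sup_{γ∈ℱ}min_{ξ∈K}Ψ(γ(ξ)) is bounded above
and below by constants independent of the (large) parameter M. -/
theorem maxmin_value_bounded (Ω : Set ℂ) (hΩo : IsOpen Ω) (hΩc : IsConnected Ω)
    (hΩb : Bornology.IsBounded Ω) (H : ℂ → ℂ → ℝ) (hH : RegPart Ω H)
    (Z : Finset ℂ) (hZ : (Z : Set ℂ) ⊆ Ω) (α : ℂ → ℝ) (hα : ∀ p ∈ Z, 0 < α p)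
    (N : ℕ) (hN : 1 ≤ N) (θ : ℂ → ℝ) (δ : ℝ) (hδ0 : 0 < δ) (hδπ : δ < π / 2)
    (hcones : ∀ p ∈ Z, ∀ q ∈ Z, p ≠ q → Disjoint (coneAt θ δ p) (coneAt θ δ q))
    (hdist : ∀ p ∈ Z, 2 * δ < Metric.infDist p (frontier Ω))
    (hsepZ : ∀ p ∈ Z, ∀ q ∈ Z, p ≠ q → 4 * δ < ‖p - q‖)
    (m : ℕ) (hm : 1 ≤ m) (P : Fin m → ℂ) (hPinj : Function.Injective P)
    (hPZ : ∀ r, P r ∈ Z) (Nr : Fin m → ℕ) (hNr1 : ∀ r, 1 ≤ Nr r)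
    (hNrα : ∀ r, (Nr r : ℝ) < 1 + α (P r)) (hNsum : N = ∑ r, Nr r)
    (ξ0 : Fin N → ℂ)
    (hξ0 : ∀ r : Fin m, ∀ j : Fin N, inBlk Nr r j →
      ξ0 j = P r + ((3 / 2 * δ : ℝ) : ℂ) *
        Complex.exp (((θ (P r) + ((j : ℕ) + 1) * δ / (N : ℝ) : ℝ) : ℂ) * Complex.I)) :
    ∃ c C M₀ : ℝ, 0 < M₀ ∧ ∀ M : ℝ, M₀ ≤ M →
      ξ0 ∈ Wset δ P Nr ξ0 M ∧ Kset δ P Nr ξ0 M ⊆ Dset Ω H Z α M ∧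
      c ≤ PsiStar Ω H Z α δ P Nr ξ0 M ∧ PsiStar Ω H Z α δ P Nr ξ0 M ≤ C := by
  choose b hb using exists_inBlk Nr hNsum
  have hbu : ∀ {r j}, inBlk Nr r j → b j = r := fun h => inBlk_unique (hb _) h
  set q : Fin N → ℂ := fun j => P (b j) with hqdef
  set β : Fin N → ℝ := fun j => θ (q j) + ((j : ℕ) + 1) * δ / (N : ℝ) with hβdef
  have hα0 : ∀ p ∈ Z, 0 ≤ α p := fun p hp => (hα p hp).le
  have hq : ∀ j, q j ∈ Z := fun j => hPZ _
  have hN0 : (0 : ℝ) < N := by exact_mod_cast hN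
  have hcfg : ∀ M, cfgOpen δ P Nr N M = sepAnnuli δ q M := by
    refine fun M => Set.ext fun ξ => and_congr_left fun _ =>
      ⟨fun h j => h _ j (hb j), fun h r j hj => ?_⟩
    rw [← hbu hj]
    exact h j
  have hξ0' : ξ0 = fun j => polarPt (q j) (3 / 2 * δ) (β j) := funext fun j => hξ0 _ j (hb j)
  have hcard : ∀ j, ((Finset.univ.filter fun k => q j = q k).card : ℝ) ≤ 1 + α (q j) := by
    intro j
    refine le_trans ?_ (hNrα (b j)).le
    exact_mod_cast card_inBlk_le Nr (b j) _ fun k hk => by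
      rw [hPinj (Finset.mem_filter.1 hk).2]
      exact hb k
  have hβ : ∀ j k, j ≠ k → q j = q k → Real.cos (β j - β k) < 1 := by
    intro j k hjk h
    have hdiff : β j - β k = (((j : ℕ) : ℝ) - (k : ℕ)) * (δ / N) := by
      simp only [hβdef, h]
      ring
    have hδN : 0 < δ / N := div_pos hδ0 hN0
    have hbound : ∀ i : Fin N, ((i : ℕ) : ℝ) * (δ / N) < δ := fun i => by
      have : ((i : ℕ) : ℝ) < N := by exact_mod_cast i.2
      calc ((i : ℕ) : ℝ) * (δ / N) < N * (δ / N) := by gcongr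
        _ = δ := by field_simp
    have hnonneg : ∀ i : Fin N, 0 ≤ ((i : ℕ) : ℝ) * (δ / N) := fun i => by positivity
    have hne : β j - β k ≠ 0 := by
      rw [hdiff]
      refine mul_ne_zero (sub_ne_zero.2 fun h => hjk (Fin.ext (by exact_mod_cast h))) hδN.ne'
    refine lt_of_le_of_ne (Real.cos_le_one _) fun h1 => hne
      ((Real.cos_eq_one_iff_of_lt_of_lt ?_ ?_).1 h1)
    · rw [hdiff, sub_mul]
      linarith [hbound k, hnonneg j]
    · rw [hdiff, sub_mul]
      linarith [hbound j, hnonneg k]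
  have hrays : ∀ j k, q j ≠ q k → ∀ ρ σ : ℝ, 0 ≤ ρ → 0 ≤ σ →
      polarPt (q j) ρ (β j) ≠ polarPt (q k) σ (β k) := by
    have hmem : ∀ j (ρ : ℝ), 0 ≤ ρ → polarPt (q j) ρ (β j) ∈ coneAt θ δ (q j) := by
      refine fun j ρ hρ => ⟨ρ, hρ, ((j : ℕ) + 1) * δ / N, ?_, rfl⟩
      rw [abs_of_nonneg (by positivity), div_le_iff₀ hN0, mul_comm]
      have : ((j : ℕ) : ℝ) + 1 ≤ N := by exact_mod_cast j.2
      gcongr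
    exact fun j k hjk ρ σ hρ hσ => (hcones _ (hq j) _ (hq k) hjk).ne_of_mem
      (hmem j ρ hρ) (hmem k σ hσ)
  obtain ⟨D, A, hDA⟩ := hH.exists_bounds hΩo hΩb hZ hδ0.le hdist
  obtain ⟨C, hC⟩ := hDA.exists_PsiFun_le hδ0.le hH.2 hα0 hq hcard hβ hrays
  obtain ⟨c, hc⟩ := hDA.closure_sepAnnuli hδ0 hsepZ hα0 hq
  obtain ⟨ρ, hρ, hT⟩ := exists_torusPt_mem_connectedComponentIn hδ0
    (fun j k => hsepZ _ (hq j) _ (hq k)) hβ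
  obtain ⟨M₀, hM₀⟩ := eventually_atTop.1 (hc.and hT)
  refine ⟨c, max C 0, max M₀ 1, by positivity, fun M hM => ?_⟩
  obtain ⟨hMc, hM0, hMT⟩ := hM₀ M ((le_max_left _ _).trans hM)
  rw [← hξ0'] at hM0 hMT
  have hKsub : Kset δ P Nr ξ0 M ⊆ closure (sepAnnuli δ q M) := by
    rw [Kset, Wset, hcfg]
    exact closure_mono (connectedComponentIn_subset _ _)
  have hW0 : ξ0 ∈ Wset δ P Nr ξ0 M := by
    rw [Wset, hcfg]
    exact mem_connectedComponentIn hM0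
  have hTK : ∀ x, torusPt q ρ x ∈ Kset δ P Nr ξ0 M := fun x => by
    rw [Kset, Wset, hcfg]
    exact subset_closure (hMT x)
  have hKD : Kset δ P Nr ξ0 M ⊆ Dset Ω H Z α M := fun ξ hξ => (hMc ξ (hKsub hξ)).1
  have hid : inF Ω H Z α δ P Nr ξ0 M id :=
    ⟨continuousOn_id, hKD, Prod.snd, continuousOn_snd, fun z hz => hKD hz.2, fun _ _ => rfl,
      fun _ _ => rfl, fun _ _ _ _ => rfl⟩
  have hupper : ∀ v ∈ {v | ∃ γ : (Fin N → ℂ) → (Fin N → ℂ), inF Ω H Z α δ P Nr ξ0 M γ ∧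
      v = sInf ((fun ξ => PsiFun H Z α (γ ξ)) '' Kset δ P Nr ξ0 M)}, v ≤ max C 0 := by
    rintro v ⟨γ, ⟨-, -, Γ, hΓ, hΓD, hΓ0, hΓ1, -⟩, rfl⟩
    by_cases hbdd : BddBelow ((fun ξ => PsiFun H Z α (γ ξ)) '' Kset δ P Nr ξ0 M)
    · obtain ⟨x, hx⟩ := exists_torusPt_mem_rays hρ hTK hΓ hΓ0 (fun t ht ξ hξ j h =>
        ((hΓD (mk_mem_prod ht hξ)).1.1 j).2 (h ▸ hq j)) β
      refine (csInf_le hbdd ⟨_, hTK x, rfl⟩).trans ((hC _ (fun j => ?_) fun j => ?_).trans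
        (le_max_left _ _))
      · rw [← hΓ1 _ (hTK x)]
        exact ((hΓD (mk_mem_prod (right_mem_Icc.2 zero_le_one) (hTK x))).1.1 j).1
      · rw [← hΓ1 _ (hTK x)]
        exact hx j
    · rw [Real.sInf_of_not_bddBelow hbdd]
      exact le_max_right _ _
  refine ⟨hW0, hKD, ?_, csSup_le ⟨_, id, hid, rfl⟩ hupper⟩
  refine le_trans ?_ (le_csSup ⟨_, hupper⟩ ⟨id, hid, rfl⟩)
  refine le_csInf ⟨_, ξ0, subset_closure hW0, rfl⟩ ?_
  rintro _ ⟨ξ, hξ, rfl⟩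
  exact (hMc ξ (hKsub hξ)).2
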